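/- arXiv:2102.04393 — 2 statements merged into one kernel-verified Lean document; each statement's English description precedes it below -/
import Mathlib

section
/- Assume (A, B) is controllable and (C, A) is observable. Then the set 𝒞_n of full-order stabilizing controllers has at most two path-connected components: there exist subsets S₁, S₂ ⊆ 𝒞_n, each nonempty and path-connected, with 𝒞_n = S₁ ∪ S₂. -/
open Matrix

noncomputable section

/-- A real square matrix is stable (Hurwitz): every eigenvalue of the matrix,
regarded as a complex matrix, has negative real part. -/
def IsStableMatrix {k : Type*} [Fintype k] [DecidableEq k] (M : Matrix k k ℝ) : Prop :=
  ∀ μ ∈ spectrum ℂ (M.map (algebraMap ℝ ℂ)), μ.re < 0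

/-- `(A, B)` is controllable: the controllability matrix `[B, A·B, …, A^{r−1}·B]` has
rank `r`. -/
def Controllable {r s : ℕ} (A : Matrix (Fin r) (Fin r) ℝ) (B : Matrix (Fin r) (Fin s) ℝ) :
    Prop :=
  (Matrix.of fun (i : Fin r) (kj : Fin r × Fin s) => (A ^ (kj.1 : ℕ) * B) i kj.2).rank = r

/-- The closed-loop matrix of the plant `(A, B, C)` with a full-order dynamic controller
`K = (A_K, B_K, C_K)`. -/
def Acl {n m p : ℕ} (A : Matrix (Fin n) (Fin n) ℝ) (B : Matrix (Fin n) (Fin m) ℝ)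
    (C : Matrix (Fin p) (Fin n) ℝ)
    (K : Matrix (Fin n) (Fin n) ℝ × Matrix (Fin n) (Fin p) ℝ × Matrix (Fin m) (Fin n) ℝ) :
    Matrix (Fin n ⊕ Fin n) (Fin n ⊕ Fin n) ℝ :=
  fromBlocks A (B * K.2.2) (K.2.1 * C) K.1

theorem joined_transvec {k : Type*} [Fintype k] [DecidableEq k]
    (t : TransvectionStruct k ℝ) :
    JoinedIn {M : Matrix k k ℝ | 0 < M.det} 1 t.toMatrix := by
  refine JoinedIn.ofLine (f := fun s : ℝ => transvection t.i t.j (s * t.c)) ?_ ?_ ?_ ?_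
  · apply Continuous.continuousOn
    unfold transvection
    refine continuous_const.add ?_
    refine continuous_matrix fun a b => ?_
    by_cases h : t.i = a ∧ t.j = b
    · obtain ⟨rfl, rfl⟩ := h
      simp only [single_apply_same]
      fun_prop
    · simp only [single_apply_of_ne _ _ _ _ _ h]
      fun_prop
  · simp
  · simp [TransvectionStruct.toMatrix]
  · rintro _ ⟨s, -, rfl⟩
    simp [det_transvection_of_ne _ _ t.hij]

theorem joined_mul {k : Type*} [Fintype k] [DecidableEq k] {M N : Matrix k k ℝ}
    (hM : JoinedIn {M : Matrix k k ℝ | 0 < M.det} 1 M)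
    (hN : JoinedIn {M : Matrix k k ℝ | 0 < M.det} 1 N) :
    JoinedIn {M : Matrix k k ℝ | 0 < M.det} 1 (M * N) := by
  have h := hM.mul hN
  rw [one_mul] at h
  refine h.mono ?_
  rintro _ ⟨a, ha, b, hb, rfl⟩
  simp only [Set.mem_setOf_eq, det_mul] at *
  exact mul_pos ha hb

theorem ring_six {R : Type*} [Ring R] (a b : R) (haa : a * a = 0) (hbb : b * b = 0)
    (haba : a * b * a = a) (hbab : b * a * b = b) :
    ((1 + a) * (1 + -b) * (1 + a)) * ((1 + a) * (1 + -b) * (1 + a)) =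
      1 - 2 * (a * b + b * a) := by
  have h1 : (1 + a) * (1 + -b) * (1 + a) = 1 - a * b - b * a + a - b := by
    have : (1 + a) * (1 + -b) * (1 + a) =
      1 + a + a - b - a * b - b * a + a * a - a * b * a := by noncomm_ring
    rw [this, haa, haba]; noncomm_ring
  rw [h1]
  have : (1 - a * b - b * a + a - b) * (1 - a * b - b * a + a - b) =
      1 - 2 * (a * b + b * a) + 2 * a - 2 * b + (a * b * a) * b + a * (b * b) * a + b * (a * a) * b
      + (b * a * b) * a - (a * b * a) + a * (b * b) - b * (a * a) + (b * a * b)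
      - (a * a) * b - (a * b * a) + (b * a * b) + (b * b) * a + a * a - a * b - b * a + b * b := by
    noncomm_ring
  rw [this, haa, hbb, haba, hbab]; noncomm_ring

theorem joined_flip {k : Type*} [Fintype k] [DecidableEq k] (i j : k) (hij : i ≠ j) :
    JoinedIn {M : Matrix k k ℝ | 0 < M.det} 1
      (diagonal fun l => if l = i ∨ l = j then -1 else 1) := by
  have key : (diagonal fun l => if l = i ∨ l = j then -1 else 1 : Matrix k k ℝ) =
      (transvection i j 1 * transvection j i (-1) * transvection i j 1) *
      (transvection i j 1 * transvection j i (-1) * transvection i j 1) := by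
    have h := ring_six (single i j (1:ℝ)) (single j i 1) (by simp [hij.symm]) (by simp [hij])
      (by simp) (by simp)
    have e : single j i (-1 : ℝ) = - single j i 1 := by ext a b; simp [single_apply]; split_ifs <;> simp
    unfold transvection
    rw [e, h]
    simp only [single_mul_single_same, mul_one]
    ext a b
    by_cases hab : a = b
    · subst hab
      have h2 : (2 : Matrix k k ℝ) = diagonal (fun _ => 2) := by
        ext x y; simp [Matrix.ofNat_apply, diagonal_apply]
      rw [h2]
      by_cases h1 : a = i
      · subst h1; simp [single_apply, hij.symm]; norm_num
      · by_cases h3 : a = j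
        · subst h3; simp [single_apply, hij]; norm_num
        · simp [single_apply, h1, h3, Ne.symm h1, Ne.symm h3]
    · have h2 : (2 : Matrix k k ℝ) = diagonal (fun _ => 2) := by
        ext x y; simp [Matrix.ofNat_apply, diagonal_apply]
      rw [h2]
      simp [hab, single_apply]
      grind
  rw [key]
  have t1 := joined_transvec (⟨i, j, hij, 1⟩ : TransvectionStruct k ℝ)
  have t2 := joined_transvec (⟨j, i, hij.symm, -1⟩ : TransvectionStruct k ℝ)
  have := joined_mul (joined_mul t1 t2) t1
  exact joined_mul this this

theorem joined_diag {k : Type*} [Fintype k] [DecidableEq k] (N : ℕ) :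
    ∀ D : k → ℝ, 0 < ∏ i, D i → (Finset.univ.filter fun i => D i < 0).card = N →
    JoinedIn {M : Matrix k k ℝ | 0 < M.det} 1 (diagonal D) := by
  induction N using Nat.strong_induction_on with
  | _ N ih =>
  intro D hD hN
  have hne : ∀ i, D i ≠ 0 := fun i h => by
    rw [Finset.prod_eq_zero (Finset.mem_univ i) h] at hD; exact lt_irrefl _ hD
  by_cases h0 : ∀ i, 0 < D i
  · refine JoinedIn.ofLine (f := fun s : ℝ => diagonal (fun i => (1 - s) + s * D i)) ?_ ?_ ?_ ?_
    · apply Continuous.continuousOn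
      apply Continuous.matrix_diagonal
      fun_prop
    · simp
    · simp
    · rintro _ ⟨s, ⟨h1, h2⟩, rfl⟩
      simp only [Set.mem_setOf_eq, det_diagonal]
      refine Finset.prod_pos fun i _ => ?_
      rcases eq_or_lt_of_le h1 with rfl | h1
      · simp
      · have := mul_pos h1 (h0 i); linarith
  · push Not at h0
    obtain ⟨i, hi⟩ := h0
    have hi : D i < 0 := lt_of_le_of_ne hi (hne i)
    have : ∃ j, j ≠ i ∧ D j < 0 := by
      by_contra! hc
      rw [← Finset.mul_prod_erase _ _ (Finset.mem_univ i)] at hD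
      have : 0 ≤ ∏ x ∈ Finset.univ.erase i, D x :=
        Finset.prod_nonneg fun j hj => hc j (Finset.ne_of_mem_erase hj)
      nlinarith
    obtain ⟨j, hji, hj⟩ := this
    set R : k → ℝ := fun l => if l = i ∨ l = j then -1 else 1 with hR
    have hRR : ∀ l, R l * R l = 1 := fun l => by simp only [hR]; split_ifs <;> norm_num
    have hfl := joined_flip i j hji.symm
    have hdet : 0 < ∏ l, R l := by have := hfl.target_mem; simpa [hR] using this
    have e : diagonal D = diagonal (fun l => D l * R l) * diagonal R := by
      rw [diagonal_mul_diagonal]; congr 1; ext l; rw [mul_assoc, hRR, mul_one]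
    rw [e]
    refine joined_mul (ih _ ?_ _ ?_ rfl) hfl
    · rw [← hN]
      refine Finset.card_lt_card ?_
      rw [Finset.ssubset_iff_of_subset]
      · exact ⟨i, by simpa using hi, by simp [hR]; exact hi.le⟩
      · intro l hl
        simp only [Finset.mem_filter, Finset.mem_univ, true_and, hR] at hl ⊢
        by_cases h : l = i ∨ l = j
        · rcases h with rfl | rfl <;> assumption
        · simpa [h] using hl
    · rw [Finset.prod_mul_distrib]; exact mul_pos hD hdet

theorem pc_pos {k : Type*} [Fintype k] [DecidableEq k] :
    IsPathConnected {M : Matrix k k ℝ | 0 < M.det} := by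
  refine ⟨1, by simp, fun {M} hM => ?_⟩
  refine diagonal_transvection_induction _ M ?_ joined_transvec (fun A B => joined_mul)
  intro D hD
  refine joined_diag _ D ?_ rfl
  rw [← det_diagonal, hD]; exact hM

theorem pc_neg {n : ℕ} (hn : 0 < n) :
    IsPathConnected {M : Matrix (Fin n) (Fin n) ℝ | M.det < 0} := by
  set E : Matrix (Fin n) (Fin n) ℝ := diagonal (fun i => if i = ⟨0, hn⟩ then -1 else 1) with hE
  have hdet : E.det = -1 := by simp [hE, det_diagonal]
  have hEE : E * E = 1 := by
    rw [hE, diagonal_mul_diagonal, ← diagonal_one]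
    congr 1; ext i; split_ifs <;> norm_num
  have : {M : Matrix (Fin n) (Fin n) ℝ | M.det < 0} = (fun M => E * M) '' {M | 0 < M.det} := by
    ext M
    simp only [Set.mem_setOf_eq, Set.mem_image]
    constructor
    · intro h
      exact ⟨E * M, by rw [det_mul, hdet]; linarith, by rw [← Matrix.mul_assoc, hEE, one_mul]⟩
    · rintro ⟨N, hN, rfl⟩
      rw [det_mul, hdet]; linarith
  rw [this]
  exact pc_pos.image (by fun_prop)

/-- Positive definiteness of the quadratic form of a (not necessarily symmetric) matrix. -/
def QPos {k : Type*} [Fintype k] (M : Matrix k k ℝ) : Prop :=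
  ∀ x : k → ℝ, x ≠ 0 → 0 < x ⬝ᵥ (M *ᵥ x)

/-- Lyapunov certificate. -/
def Lyap {k : Type*} [Fintype k] (M : Matrix k k ℝ) : Prop :=
  ∃ P : Matrix k k ℝ, Pᵀ = P ∧ QPos P ∧ QPos (-(M * P))

theorem QPos.eventually {k : Type*} [Fintype k] {M : Matrix k k ℝ} (h : QPos M) :
    ∀ᶠ N in nhds M, QPos N := by
  have h1 : ∀ᶠ N in nhds M, ∀ x ∈ Metric.sphere (0 : k → ℝ) 1, 0 < x ⬝ᵥ (N *ᵥ x) := by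
    refine (isCompact_sphere (0 : k → ℝ) 1).eventually_forall_of_forall_eventually ?_
    intro y hy
    have hy0 : y ≠ 0 := by rintro rfl; simp at hy
    have hc : Continuous fun z : Matrix k k ℝ × (k → ℝ) => z.2 ⬝ᵥ (z.1 *ᵥ z.2) := by fun_prop
    exact hc.continuousAt.eventually (lt_mem_nhds (h y hy0))
  filter_upwards [h1] with N hN x hx
  have hn : 0 < ‖x‖ := norm_pos_iff.2 hx
  have := hN (‖x‖⁻¹ • x) (by simp [norm_smul, hn.ne'])
  rw [mulVec_smul, smul_dotProduct, dotProduct_smul, smul_eq_mul, smul_eq_mul] at this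
  have h2 : 0 < ‖x‖⁻¹ := inv_pos.2 hn
  exact (mul_pos_iff_of_pos_left h2).1 ((mul_pos_iff_of_pos_left h2).1 this)

theorem QPos.congr {k : Type*} [Fintype k] [DecidableEq k] {M T S : Matrix k k ℝ} (h : QPos M)
    (hST : S * T = 1) : QPos (Tᵀ * M * T) := by
  intro x hx
  have h1 : T *ᵥ x ≠ 0 := by
    intro h0
    apply hx
    have := congrArg (S *ᵥ ·) h0
    simpa [mulVec_mulVec, hST] using this
  have := h _ h1
  rw [Matrix.mul_assoc, ← mulVec_mulVec, ← mulVec_mulVec, dotProduct_mulVec x, vecMul_transpose]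
  exact this

theorem QPos.add {k : Type*} [Fintype k] {M N : Matrix k k ℝ} (h : QPos M) (h' : QPos N) :
    QPos (M + N) := fun x hx => by
  rw [add_mulVec, dotProduct_add]; exact add_pos (h x hx) (h' x hx)

theorem QPos.smul {k : Type*} [Fintype k] {M : Matrix k k ℝ} (h : QPos M) {c : ℝ} (hc : 0 < c) :
    QPos (c • M) := fun x hx => by
  rw [smul_mulVec, dotProduct_smul]; exact mul_pos hc (h x hx)

theorem QPos.one {k : Type*} [Fintype k] [DecidableEq k] : QPos (1 : Matrix k k ℝ) :=
  fun x hx => by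
  rw [one_mulVec]
  exact lt_of_le_of_ne (Finset.sum_nonneg fun i _ => mul_self_nonneg _) (Ne.symm (by simpa using hx))

theorem dot_mul_transpose {k l : Type*} [Fintype k] [Fintype l] (T : Matrix k l ℝ) (x : k → ℝ) :
    x ⬝ᵥ ((T * Tᵀ) *ᵥ x) = (Tᵀ *ᵥ x) ⬝ᵥ (Tᵀ *ᵥ x) := by
  rw [← mulVec_mulVec, dotProduct_mulVec, ← mulVec_transpose]

theorem QPos.inj {k : Type*} [Fintype k] {M : Matrix k k ℝ} (h : QPos M) {x : k → ℝ}
    (hx : M *ᵥ x = 0) : x = 0 := by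
  by_contra h0
  have := h x h0
  simp [hx] at this

theorem Lyap.conj {k : Type*} [Fintype k] [DecidableEq k] {M T S : Matrix k k ℝ} (h : Lyap M)
    (hST : S * T = 1) : Lyap (T * M * S) := by
  obtain ⟨P, hs, hp, hq⟩ := h
  have hTS' : Sᵀ * Tᵀ = 1 := by
    rw [← transpose_mul, mul_eq_one_comm.1 hST, transpose_one]
  refine ⟨T * P * Tᵀ, ?_, ?_, ?_⟩
  · simp [transpose_mul, hs, Matrix.mul_assoc]
  · simpa using hp.congr (T := Tᵀ) hTS'
  · have := hq.congr (T := Tᵀ) hTS'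
    convert this using 1
    calc -(T * M * S * (T * P * Tᵀ)) = -(T * M * (S * T) * P * Tᵀ) := by noncomm_ring
      _ = _ := by rw [hST, transpose_transpose]; noncomm_ring

theorem Lyap.stable {k : Type*} [Fintype k] [DecidableEq k] {M : Matrix k k ℝ} (h : Lyap M) :
    IsStableMatrix M := by
  obtain ⟨P, hs, hp, hq⟩ := h
  intro μ hμ
  have hdet : (algebraMap ℂ (Matrix k k ℂ) μ - (M.map (algebraMap ℝ ℂ))).det = 0 := by
    have := hμ
    rw [spectrum.mem_iff, isUnit_iff_isUnit_det] at this
    simpa using this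
  obtain ⟨v, hv0, hv⟩ := exists_vecMul_eq_zero_iff.2 hdet
  rw [vecMul_sub, sub_eq_zero] at hv
  have hv' : v ᵥ* M.map (algebraMap ℝ ℂ) = μ • v := by
    rw [← hv]; ext i; simp [algebraMap_eq_diagonal, vecMul_diagonal, mul_comm]
  set a : k → ℝ := fun i => (v i).re with ha
  set b : k → ℝ := fun i => (v i).im with hb
  have h1 : a ᵥ* M = μ.re • a - μ.im • b := by
    ext i
    have := congrArg Complex.re (congrFun hv' i)
    simp only [vecMul, dotProduct, Complex.re_sum, map_apply, Complex.coe_algebraMap,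
      Pi.smul_apply, smul_eq_mul, Complex.mul_re] at this
    simpa [vecMul, dotProduct, ha, hb] using this
  have h2 : b ᵥ* M = μ.im • a + μ.re • b := by
    ext i
    have := congrArg Complex.im (congrFun hv' i)
    simp only [vecMul, dotProduct, Complex.im_sum, map_apply, Complex.coe_algebraMap,
      Pi.smul_apply, smul_eq_mul, Complex.mul_im] at this
    simp only [Complex.ofReal_re, Complex.ofReal_im, mul_zero, zero_add] at this
    simp [vecMul, dotProduct, ha, hb, this]; ring
  have hab : a ≠ 0 ∨ b ≠ 0 := by
    by_contra! hc
    apply hv0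
    ext i
    exact Complex.ext (congrFun hc.1 i) (congrFun hc.2 i)
  have hsym : b ⬝ᵥ (P *ᵥ a) = a ⬝ᵥ (P *ᵥ b) := by
    rw [dotProduct_mulVec, dotProduct_comm, ← mulVec_transpose, hs]
  have qa : a ⬝ᵥ (-(M * P) *ᵥ a) = -(μ.re * (a ⬝ᵥ (P *ᵥ a)) - μ.im * (a ⬝ᵥ (P *ᵥ b))) := by
    rw [neg_mulVec, dotProduct_neg, ← mulVec_mulVec, dotProduct_mulVec a, h1, sub_dotProduct,
      smul_dotProduct, smul_dotProduct, hsym]; rfl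
  have qb : b ⬝ᵥ (-(M * P) *ᵥ b) = -(μ.im * (a ⬝ᵥ (P *ᵥ b)) + μ.re * (b ⬝ᵥ (P *ᵥ b))) := by
    rw [neg_mulVec, dotProduct_neg, ← mulVec_mulVec, dotProduct_mulVec b, h2, add_dotProduct,
      smul_dotProduct, smul_dotProduct]; rfl
  have nn : ∀ (N : Matrix k k ℝ), QPos N → ∀ x, 0 ≤ x ⬝ᵥ (N *ᵥ x) := by
    intro N hN x
    by_cases hx : x = 0
    · simp [hx]
    · exact (hN x hx).le
  have s1 : 0 < a ⬝ᵥ (P *ᵥ a) + b ⬝ᵥ (P *ᵥ b) := by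
    rcases hab with h | h
    · exact add_pos_of_pos_of_nonneg (hp a h) (nn P hp b)
    · exact add_pos_of_nonneg_of_pos (nn P hp a) (hp b h)
  have s2 : 0 < a ⬝ᵥ (-(M * P) *ᵥ a) + b ⬝ᵥ (-(M * P) *ᵥ b) := by
    rcases hab with h | h
    · exact add_pos_of_pos_of_nonneg (hq a h) (nn _ hq b)
    · exact add_pos_of_nonneg_of_pos (nn _ hq a) (hq b h)
  rw [qa, qb] at s2
  by_contra! hc
  nlinarith

section PowZero

attribute [local instance] Matrix.linftyOpNormedRing Matrix.linftyOpNormedAlgebra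

theorem pow_tendsto_zero {k : Type*} [Fintype k] [DecidableEq k] [Nonempty k]
    (W : Matrix k k ℂ) (h : ∀ z ∈ spectrum ℂ W, ‖z‖ < 1) :
    Filter.Tendsto (fun N : ℕ => W ^ N) Filter.atTop (nhds 0) := by
  have hr : spectralRadius ℂ W < (1 : NNReal) :=
    spectrum.spectralRadius_lt_of_forall_lt W (fun z hz => by
      have := h z hz
      exact_mod_cast this)
  obtain ⟨r, hr1, hr2⟩ := ENNReal.lt_iff_exists_nnreal_btwn.1 hr
  have hg := spectrum.pow_nnnorm_pow_one_div_tendsto_nhds_spectralRadius W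
  have hev := hg.eventually (gt_mem_nhds hr1)
  have hr2' : (r : ℝ) < 1 := by exact_mod_cast hr2
  refine squeeze_zero_norm' (a := fun N => (r : ℝ) ^ N) ?_
    (tendsto_pow_atTop_nhds_zero_of_lt_one r.2 hr2')
  filter_upwards [hev, Filter.eventually_gt_atTop 0] with N hN hN0
  have h1 : ((‖W ^ N‖₊ : ENNReal) ^ (1 / (N : ℝ))) ^ (N : ℝ) ≤ (r : ENNReal) ^ (N : ℝ) :=
    ENNReal.rpow_le_rpow hN.le (by positivity)
  rw [← ENNReal.rpow_mul, one_div_mul_cancel (by positivity), ENNReal.rpow_one,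
    ENNReal.rpow_natCast] at h1
  have h2 : ‖W ^ N‖₊ ≤ r ^ N := by exact_mod_cast h1
  exact_mod_cast h2

end PowZero

theorem IsStableMatrix.lyap {k : Type*} [Fintype k] [DecidableEq k] {M : Matrix k k ℝ}
    (h : IsStableMatrix M) : Lyap M := by
  rcases isEmpty_or_nonempty k with hk | hk
  · exact ⟨0, by simp, fun x hx => absurd (Subsingleton.elim _ _) hx,
      fun x hx => absurd (Subsingleton.elim _ _) hx⟩
  set Mc := M.map (algebraMap ℝ ℂ) with hMc
  have hfin : (spectrum ℂ Mc).Finite := Matrix.finite_spectrum Mc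
  have hε : ∀ᶠ ε : ℝ in nhdsWithin 0 (Set.Ioi 0), ∀ μ ∈ spectrum ℂ Mc, ‖1 + (ε : ℂ) * μ‖ < 1 := by
    rw [hfin.eventually_all]
    intro μ hμ
    have hre := h μ hμ
    have hc : Continuous fun ε : ℝ => 2 * μ.re + ε * (μ.re ^ 2 + μ.im ^ 2) := by fun_prop
    have h1 : ∀ᶠ ε : ℝ in nhdsWithin 0 (Set.Ioi 0), 2 * μ.re + ε * (μ.re ^ 2 + μ.im ^ 2) < 0 :=
      (hc.continuousAt.eventually (gt_mem_nhds (by simp only [zero_mul, add_zero]; linarith))).filter_mono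
        nhdsWithin_le_nhds
    filter_upwards [h1, self_mem_nhdsWithin] with ε h2 h3
    have h3 : 0 < ε := h3
    have h4 : ‖1 + (ε : ℂ) * μ‖ ^ 2 < 1 := by
      rw [← Complex.normSq_eq_norm_sq, Complex.normSq_apply]
      simp
      nlinarith
    nlinarith [norm_nonneg (1 + (ε : ℂ) * μ)]
  obtain ⟨ε, hε1, hε0⟩ := (hε.and self_mem_nhdsWithin).exists
  have hε0 : 0 < ε := hε0
  set W : Matrix k k ℝ := 1 + ε • M with hW
  have hWc : W.map (algebraMap ℝ ℂ) = 1 + (ε : ℂ) • Mc := by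
    ext i j; simp [hW, hMc, Matrix.one_apply]; split_ifs <;> simp
  have hspec : ∀ z ∈ spectrum ℂ (W.map (algebraMap ℝ ℂ)), ‖z‖ < 1 := by
    intro z hz
    have hεc : (ε : ℂ) ≠ 0 := by exact_mod_cast hε0.ne'
    have hz' : (z - 1) / ε ∈ spectrum ℂ Mc := by
      rw [spectrum.mem_iff] at hz ⊢
      intro hu
      apply hz
      have := hu.smul (Units.mk0 (ε : ℂ) hεc)
      convert this using 1
      rw [hWc]
      rw [Units.smul_def, Units.val_mk0, Algebra.algebraMap_eq_smul_one, Algebra.algebraMap_eq_smul_one, smul_sub, smul_smul,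
        mul_div_cancel₀ _ hεc, sub_smul, one_smul]
      abel
    have := hε1 _ hz'
    rwa [mul_div_cancel₀ _ hεc, add_sub_cancel] at this
  have ht := pow_tendsto_zero _ hspec
  have htr : Filter.Tendsto (fun N : ℕ => W ^ N) Filter.atTop (nhds 0) := by
    have hc : Continuous fun X : Matrix k k ℂ => X.map Complex.re :=
      continuous_id.matrix_map Complex.continuous_re
    have := (hc.tendsto 0).comp ht
    have e0 : (0 : Matrix k k ℂ).map Complex.re = 0 := by ext; simp
    rw [e0] at this
    refine this.congr fun N => ?_
    have : (W.map (algebraMap ℝ ℂ)) ^ N = (W ^ N).map (algebraMap ℝ ℂ) :=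
      (map_pow (RingHom.mapMatrix (algebraMap ℝ ℂ)) W N).symm
    simp only [Function.comp, this]
    ext i j; simp
  have hev : ∀ᶠ N : ℕ in Filter.atTop, QPos (1 - W ^ N * (W ^ N)ᵀ) := by
    have hc : Continuous fun X : Matrix k k ℝ => 1 - X * Xᵀ := by fun_prop
    have h1 := (hc.tendsto 0).comp htr
    refine h1.eventually ?_
    have : (1 - (0 : Matrix k k ℝ) * 0ᵀ) = 1 := by simp
    rw [this]
    exact QPos.one.eventually
  obtain ⟨N, hN, hN0⟩ := (hev.and (Filter.eventually_gt_atTop 0)).exists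
  set P : Matrix k k ℝ := ∑ i ∈ Finset.range N, W ^ i * (W ^ i)ᵀ with hP
  have hPs : Pᵀ = P := by simp [hP, transpose_sum, transpose_mul]
  have hnn : ∀ (T : Matrix k k ℝ) (x : k → ℝ), 0 ≤ x ⬝ᵥ ((T * Tᵀ) *ᵥ x) := fun T x => by
    rw [dot_mul_transpose]; exact Finset.sum_nonneg fun i _ => mul_self_nonneg _
  have hPp : QPos P := by
    intro x hx
    rw [hP, sum_mulVec, dotProduct_sum]
    refine Finset.sum_pos' (fun i _ => hnn _ _) ⟨0, by simpa using hN0, ?_⟩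
    simpa using QPos.one x hx
  refine ⟨P, hPs, hPp, ?_⟩
  have hWP : P - W * P * Wᵀ = 1 - W ^ N * (W ^ N)ᵀ := by
    have : W * P * Wᵀ = ∑ i ∈ Finset.range N, W ^ (i + 1) * (W ^ (i + 1))ᵀ := by
      rw [hP, Finset.mul_sum, Finset.sum_mul]
      refine Finset.sum_congr rfl fun i _ => ?_
      rw [pow_succ', transpose_mul]; simp only [Matrix.mul_assoc]
    rw [this, hP, ← Finset.sum_sub_distrib, Finset.sum_range_sub']
    simp
  intro x hx
  have h1 := hN x hx
  rw [← hWP] at h1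
  have e1 : P - W * P * Wᵀ = -(ε • (M * P)) - ε • (M * P)ᵀ - (ε ^ 2) • (M * P * Mᵀ) := by
    rw [hW, transpose_add, transpose_one, transpose_smul, transpose_mul, hPs]
    simp only [add_mul, mul_add, one_mul, mul_one, smul_mul_assoc, mul_smul_comm, smul_add,
      smul_smul, sq]
    abel
  rw [e1, sub_mulVec, sub_mulVec, neg_mulVec, dotProduct_sub, dotProduct_sub, dotProduct_neg,
    smul_mulVec, smul_mulVec, smul_mulVec, dotProduct_smul, dotProduct_smul, dotProduct_smul] at h1
  have e2 : x ⬝ᵥ ((M * P)ᵀ *ᵥ x) = x ⬝ᵥ ((M * P) *ᵥ x) := by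
    rw [mulVec_transpose, dotProduct_comm, dotProduct_mulVec]
  have e3 : 0 ≤ x ⬝ᵥ ((M * P * Mᵀ) *ᵥ x) := by
    have : x ⬝ᵥ ((M * P * Mᵀ) *ᵥ x) = (Mᵀ *ᵥ x) ⬝ᵥ (P *ᵥ (Mᵀ *ᵥ x)) := by
      rw [Matrix.mul_assoc, ← mulVec_mulVec, ← mulVec_mulVec, dotProduct_mulVec x,
        ← mulVec_transpose M x]
    rw [this]
    by_cases hx : Mᵀ *ᵥ x = 0
    · simp [hx]
    · exact (hPp _ hx).le
  rw [e2] at h1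
  rw [neg_mulVec, dotProduct_neg]
  simp only [smul_eq_mul] at h1
  by_contra! hc
  have : 0 ≤ ε ^ 2 * (x ⬝ᵥ ((M * P * Mᵀ) *ᵥ x)) := by positivity
  nlinarith

theorem stable_iff_lyap {k : Type*} [Fintype k] [DecidableEq k] {M : Matrix k k ℝ} :
    IsStableMatrix M ↔ Lyap M := ⟨IsStableMatrix.lyap, Lyap.stable⟩

theorem Controllable.eq_zero {r s : ℕ} {A : Matrix (Fin r) (Fin r) ℝ} {B : Matrix (Fin r) (Fin s) ℝ}
    (h : Controllable A B) {y : Fin r → ℝ} (hy : ∀ k < r, y ᵥ* (A ^ k * B) = 0) : y = 0 := by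
  set R := (Matrix.of fun (i : Fin r) (kj : Fin r × Fin s) => (A ^ (kj.1 : ℕ) * B) i kj.2) with hR
  have h1 : R.rank = r := h
  have h2 : Rᵀ *ᵥ y = 0 := by
    rw [mulVec_transpose]
    ext ⟨k, j⟩
    exact congrFun (hy k k.2) j
  rw [← rank_transpose, Matrix.rank] at h1
  have h3 := LinearMap.finrank_range_add_finrank_ker Rᵀ.mulVecLin
  rw [h1, Module.finrank_fin_fun] at h3
  have h4 : Module.finrank ℝ (LinearMap.ker Rᵀ.mulVecLin) = 0 := by omega
  rw [Submodule.finrank_eq_zero] at h4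
  have : y ∈ LinearMap.ker Rᵀ.mulVecLin := h2
  rwa [h4, Submodule.mem_bot] at this

theorem ctrb_lmi {n m : ℕ} {A : Matrix (Fin n) (Fin n) ℝ} {B : Matrix (Fin n) (Fin m) ℝ}
    (h : Controllable A B) : ∃ (X : Matrix (Fin n) (Fin n) ℝ) (F : Matrix (Fin m) (Fin n) ℝ),
      Xᵀ = X ∧ QPos X ∧ QPos (-(A * X + B * F)) := by
  obtain ⟨s, hs1, hs⟩ : ∃ s : ℝ, 1 < s ∧ IsUnit (s • (1 : Matrix (Fin n) (Fin n) ℝ) + A) := by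
    have hf : (spectrum ℝ (-A)).Finite := Matrix.finite_spectrum _
    obtain ⟨s, hs, hs'⟩ := (Set.Ioi_infinite (1 : ℝ)).exists_notMem_finite hf
    refine ⟨s, hs, ?_⟩
    rw [spectrum.mem_iff, not_not, Algebra.algebraMap_eq_smul_one, sub_neg_eq_add] at hs'
    exact hs'
  set S := s • (1 : Matrix (Fin n) (Fin n) ℝ) + A with hS
  obtain ⟨u, hu⟩ := hs
  obtain ⟨W, hSW, hWS⟩ : ∃ W : Matrix (Fin n) (Fin n) ℝ, S * W = 1 ∧ W * S = 1 :=
    ⟨(u⁻¹).val, by rw [← hu]; exact u.mul_inv, by rw [← hu]; exact u.inv_mul⟩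
  set X : Matrix (Fin n) (Fin n) ℝ :=
    ∑ k ∈ Finset.range n, (W ^ (k + 1) * B) * (W ^ (k + 1) * B)ᵀ with hX
  have hXs : Xᵀ = X := by
    rw [hX, transpose_sum]
    refine Finset.sum_congr rfl fun k _ => ?_
    rw [transpose_mul, transpose_transpose]
  have hnn : ∀ (l : ℕ) (T : Matrix (Fin n) (Fin l) ℝ) (x : Fin n → ℝ),
      0 ≤ x ⬝ᵥ ((T * Tᵀ) *ᵥ x) := fun l T x => by
    rw [dot_mul_transpose]; exact Finset.sum_nonneg fun i _ => mul_self_nonneg _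
  have hXnn : ∀ x, 0 ≤ x ⬝ᵥ (X *ᵥ x) := by
    intro x
    rw [hX, sum_mulVec, dotProduct_sum]
    exact Finset.sum_nonneg (fun i _ => hnn _ _ _)
  have hXp : QPos X := by
    intro x hx
    refine lt_of_le_of_ne (hXnn x) fun h0 => hx ?_
    rw [hX, sum_mulVec, dotProduct_sum, eq_comm,
      Finset.sum_eq_zero_iff_of_nonneg (fun i _ => hnn _ _ _)] at h0
    have h1 : ∀ k < n, x ᵥ* (W ^ (k + 1) * B) = 0 := by
      intro k hk
      have := h0 k (Finset.mem_range.2 hk)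
      rw [dot_mul_transpose, dotProduct_self_eq_zero, mulVec_transpose] at this
      exact this
    have hcan : ∀ j, W ^ j * S ^ j = 1 := by
      intro j
      have hc : Commute W S := by rw [Commute, SemiconjBy, hSW, hWS]
      rw [← hc.mul_pow, hWS, one_pow]
    have hcan' : ∀ j, S ^ j * W ^ j = 1 := by
      intro j
      have hc : Commute S W := by rw [Commute, SemiconjBy, hSW, hWS]
      rw [← hc.mul_pow, hSW, one_pow]
    have h2 : ∀ j < n, (x ᵥ* W ^ n) ᵥ* (S ^ j * B) = 0 := by
      intro j hj
      have e : W ^ n * S ^ j = W ^ (n - j - 1 + 1) := by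
        have : W ^ n = W ^ ((n - j - 1 + 1) + j) := by congr 1; omega
        rw [this, pow_add, Matrix.mul_assoc, hcan, mul_one]
      rw [vecMul_vecMul, ← Matrix.mul_assoc, e]
      exact h1 _ (by omega)
    have h3 : ∀ j < n, (x ᵥ* W ^ n) ᵥ* (A ^ j * B) = 0 := by
      intro j hj
      have eA : A = S + (-s) • (1 : Matrix (Fin n) (Fin n) ℝ) := by
        rw [hS, neg_smul]; abel
      have hc : Commute S ((-s) • (1 : Matrix (Fin n) (Fin n) ℝ)) :=
        (Commute.one_right S).smul_right _
      rw [eA, hc.add_pow, Matrix.sum_mul]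
      have : ∀ (w : Fin n → ℝ) (t : Finset ℕ) (f : ℕ → Matrix (Fin n) (Fin m) ℝ),
          (∀ i ∈ t, w ᵥ* f i = 0) → w ᵥ* (∑ i ∈ t, f i) = 0 := by
        intro w t f hf
        rw [vecMul_sum]
        exact Finset.sum_eq_zero hf
      refine this _ _ _ fun i hi => ?_
      have hi' : i < n := by have := Finset.mem_range.1 hi; omega
      have e : S ^ i * (-s • (1 : Matrix (Fin n) (Fin n) ℝ)) ^ (j - i) * ((j.choose i : ℕ) : Matrix (Fin n) (Fin n) ℝ) * B =
          ((-s) ^ (j - i) * (j.choose i : ℝ)) • (S ^ i * B) := by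
        rw [smul_pow, one_pow, mul_smul_comm, mul_one, ← nsmul_eq_mul', ← Nat.cast_smul_eq_nsmul ℝ,
          smul_smul, Matrix.smul_mul, mul_comm]
      rw [e, vecMul_smul, h2 i hi', smul_zero]
    have h4 := h.eq_zero h3
    have h5 := congrArg (· ᵥ* S ^ n) h4
    simpa [vecMul_vecMul, hcan] using h5
  refine ⟨X, (-(1 / (2 * s))) • Bᵀ, hXs, hXp, ?_⟩
  have key : S * X * Sᵀ = X + B * Bᵀ - (W ^ n * B) * (W ^ n * B)ᵀ := by
    have e1 : S * X * Sᵀ = ∑ k ∈ Finset.range n, (W ^ k * B) * (W ^ k * B)ᵀ := by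
      rw [hX, Finset.mul_sum, Finset.sum_mul]
      refine Finset.sum_congr rfl fun k _ => ?_
      have : S * (W ^ (k + 1) * B) = W ^ k * B := by
        rw [pow_succ', ← Matrix.mul_assoc, ← Matrix.mul_assoc, hSW, one_mul]
      calc _ = (S * (W ^ (k + 1) * B)) * (S * (W ^ (k + 1) * B))ᵀ := by
            rw [transpose_mul S]; simp only [Matrix.mul_assoc]
        _ = _ := by rw [this]
    have e2 := Finset.sum_range_sub (fun k => (W ^ k * B) * (W ^ k * B)ᵀ) n
    rw [Finset.sum_sub_distrib, ← hX, ← e1] at e2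
    rw [pow_zero, Matrix.one_mul] at e2
    rw [eq_sub_iff_add_eq] 
    have := congrArg (· + S * X * Sᵀ + B * Bᵀ) e2
    simp only [sub_add_cancel] at this
    rw [this]; abel
  have e1 : S * X * Sᵀ = (s * s) • X + s • (A * X) + s • (A * X)ᵀ + A * X * Aᵀ := by
    rw [hS, transpose_add, transpose_smul, transpose_one, transpose_mul, hXs]
    simp only [add_mul, mul_add, one_mul, mul_one, smul_mul_assoc, mul_smul_comm, smul_smul, smul_add]
    abel
  intro x hx
  have e2 : x ⬝ᵥ ((A * X)ᵀ *ᵥ x) = x ⬝ᵥ ((A * X) *ᵥ x) := by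
    rw [mulVec_transpose, dotProduct_comm, dotProduct_mulVec]
  have e3 : 0 ≤ x ⬝ᵥ ((A * X * Aᵀ) *ᵥ x) := by
    have : x ⬝ᵥ ((A * X * Aᵀ) *ᵥ x) = (Aᵀ *ᵥ x) ⬝ᵥ (X *ᵥ (Aᵀ *ᵥ x)) := by
      rw [Matrix.mul_assoc, ← mulVec_mulVec, ← mulVec_mulVec, dotProduct_mulVec x,
        ← mulVec_transpose A x]
    rw [this]
    exact hXnn _
  have k2 := congrArg (fun T => x ⬝ᵥ (T *ᵥ x)) (e1.symm.trans key)
  simp only [add_mulVec, sub_mulVec, smul_mulVec, dotProduct_add, dotProduct_sub,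
    dotProduct_smul, e2, smul_eq_mul] at k2
  have h5 := hnn _ (W ^ n * B) x
  have h6 := hXp x hx
  rw [neg_mulVec, dotProduct_neg, add_mulVec, dotProduct_add, Matrix.mul_smul, smul_mulVec,
    dotProduct_smul, smul_eq_mul]
  set q := x ⬝ᵥ (X *ᵥ x)
  set b := x ⬝ᵥ ((B * Bᵀ) *ᵥ x)
  set a := x ⬝ᵥ ((A * X) *ᵥ x)
  have h7 : 0 < (s * s - 1) * q := mul_pos (by nlinarith) h6
  have h8 : 2 * s * a - b < 0 := by nlinarith
  have h9 : -(a + -(1 / (2 * s)) * b) = (b - 2 * s * a) / (2 * s) := by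
    field_simp; ring
  rw [h9]
  exact div_pos (by linarith) (by linarith)

/-- The parameter space `(X, Y, M, F, H)`. -/
abbrev Par (n m p : ℕ) : Type :=
  Matrix (Fin n) (Fin n) ℝ × Matrix (Fin n) (Fin n) ℝ × Matrix (Fin n) (Fin n) ℝ ×
    Matrix (Fin m) (Fin n) ℝ × Matrix (Fin n) (Fin p) ℝ

abbrev Ctl (n m p : ℕ) : Type :=
  Matrix (Fin n) (Fin n) ℝ × Matrix (Fin n) (Fin p) ℝ × Matrix (Fin m) (Fin n) ℝ

/-- The convex set of feasible parameters. -/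
def FSet {n m p : ℕ} (A : Matrix (Fin n) (Fin n) ℝ) (B : Matrix (Fin n) (Fin m) ℝ)
    (C : Matrix (Fin p) (Fin n) ℝ) : Set (Par n m p) :=
  {f | f.1ᵀ = f.1 ∧ f.2.1ᵀ = f.2.1 ∧ QPos (fromBlocks f.1 1 1 f.2.1) ∧
    QPos (-(fromBlocks (A * f.1 + B * f.2.2.2.1) A f.2.2.1 (f.2.1 * A + f.2.2.2.2 * C)))}

/-- The change of variables from parameters to controllers. -/
def Phi {n m p : ℕ} (A : Matrix (Fin n) (Fin n) ℝ) (B : Matrix (Fin n) (Fin m) ℝ)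
    (C : Matrix (Fin p) (Fin n) ℝ) (f : Par n m p) : Ctl n m p :=
  ((1 - f.2.1 * f.1)⁻¹ * (f.2.2.1 - f.2.1 * (A * f.1 + B * f.2.2.2.1) - f.2.2.2.2 * C * f.1),
    (1 - f.2.1 * f.1)⁻¹ * f.2.2.2.2, f.2.2.2.1)

/-- The similarity action. -/
def act {n m p : ℕ} (G : Matrix (Fin n) (Fin n) ℝ) (K : Ctl n m p) : Ctl n m p :=
  (G * K.1 * G⁻¹, G * K.2.1, K.2.2 * G⁻¹)

theorem FSet.convex {n m p : ℕ} (A : Matrix (Fin n) (Fin n) ℝ) (B : Matrix (Fin n) (Fin m) ℝ)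
    (C : Matrix (Fin p) (Fin n) ℝ) : Convex ℝ (FSet A B C) := by
  rw [convex_iff_forall_pos]
  rintro ⟨X, Y, M, F, H⟩ ⟨h1, h2, h3, h4⟩ ⟨X', Y', M', F', H'⟩ ⟨h1', h2', h3', h4'⟩ a b ha hb hab
  simp only at h1 h2 h3 h4 h1' h2' h3' h4'
  have one : ∀ (D : Matrix (Fin n) (Fin n) ℝ), a • D + b • D = D := fun D => by
    rw [← add_smul, hab, one_smul]
  refine ⟨?_, ?_, ?_, ?_⟩ <;> simp only [Prod.smul_mk, Prod.mk_add_mk]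
  · simp [h1, h1']
  · simp [h2, h2']
  · have := (h3.smul ha).add (h3'.smul hb)
    rw [fromBlocks_smul, fromBlocks_smul, fromBlocks_add, one] at this
    exact this
  · have := (h4.smul ha).add (h4'.smul hb)
    rw [smul_neg, smul_neg, ← neg_add, fromBlocks_smul, fromBlocks_smul, fromBlocks_add, one] at this
    have e1 : A * (a • X + b • X') + B * (a • F + b • F') =
        a • (A * X + B * F) + b • (A * X' + B * F') := by
      simp only [Matrix.mul_add, Matrix.mul_smul, smul_add]; abel
    have e2 : (a • Y + b • Y') * A + (a • H + b • H') * C =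
        a • (Y * A + H * C) + b • (Y' * A + H' * C) := by
      simp only [Matrix.add_mul, Matrix.smul_mul, smul_add]; abel
    rw [e1, e2]
    exact this

theorem isUnit_of_blocks {n : ℕ} {X Y : Matrix (Fin n) (Fin n) ℝ}
    (h : QPos (fromBlocks X 1 1 Y)) : IsUnit (1 - X * Y).det := by
  rw [isUnit_iff_ne_zero]
  intro h0
  obtain ⟨v, hv0, hv⟩ := exists_mulVec_eq_zero_iff.2 h0
  rw [sub_mulVec, one_mulVec, ← mulVec_mulVec, sub_eq_zero] at hv
  have := h.inj (x := Sum.elim (-(Y *ᵥ v)) v) (by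
    rw [fromBlocks_mulVec]
    ext i
    rcases i with i | i
    · have := congrFun hv i
      rw [mulVec_mulVec] at this
      simp [mulVec_neg]
      linarith
    · simp)
  apply hv0
  ext i
  exact congrFun this (Sum.inr i)

theorem isUnit_of_blocks' {n : ℕ} {X Y : Matrix (Fin n) (Fin n) ℝ} (hX : Xᵀ = X) (hY : Yᵀ = Y)
    (h : QPos (fromBlocks X 1 1 Y)) : IsUnit (1 - Y * X).det := by
  have := isUnit_of_blocks h
  rw [← det_transpose] at this
  simpa [transpose_mul, hX, hY] using this

theorem block_id1 {n : ℕ} {X Y N : Matrix (Fin n) (Fin n) ℝ} (hY : Yᵀ = Y) (hN : Y * X + N = 1) :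
    (fromBlocks (1 : Matrix (Fin n) (Fin n) ℝ) Y (0 : Matrix (Fin n) (Fin n) ℝ) Nᵀ)ᵀ * fromBlocks X 1 1 0 = fromBlocks X 1 1 Y := by
  rw [fromBlocks_transpose, fromBlocks_multiply]
  simp [hY, hN]

theorem block_id2 {n m p : ℕ} (A : Matrix (Fin n) (Fin n) ℝ) (B : Matrix (Fin n) (Fin m) ℝ)
    (C : Matrix (Fin p) (Fin n) ℝ) (K : Ctl n m p)
    {X Y N : Matrix (Fin n) (Fin n) ℝ} (hY : Yᵀ = Y) :
    (fromBlocks (1 : Matrix (Fin n) (Fin n) ℝ) Y (0 : Matrix (Fin n) (Fin n) ℝ) Nᵀ)ᵀ * Acl A B C K * fromBlocks X 1 1 0 =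
      fromBlocks (A * X + B * K.2.2) A
        (Y * (A * X + B * K.2.2) + N * K.2.1 * C * X + N * K.1) (Y * A + N * K.2.1 * C) := by
  rw [Acl, fromBlocks_transpose, fromBlocks_multiply, fromBlocks_multiply]
  simp only [hY, transpose_one, transpose_zero, transpose_transpose, Matrix.one_mul,
    Matrix.zero_mul, add_zero, Matrix.mul_one, Matrix.mul_zero, Matrix.add_mul, Matrix.mul_add,
    Matrix.mul_assoc]
  congr 1
  abel

theorem block_inv {n : ℕ} {Y N N' : Matrix (Fin n) (Fin n) ℝ} (h : N * N' = 1) :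
    fromBlocks (1 : Matrix (Fin n) (Fin n) ℝ) (-(Y * N'ᵀ)) (0 : Matrix (Fin n) (Fin n) ℝ) N'ᵀ * fromBlocks (1 : Matrix (Fin n) (Fin n) ℝ) Y (0 : Matrix (Fin n) (Fin n) ℝ) Nᵀ = 1 := by
  have h' : N'ᵀ * Nᵀ = 1 := by rw [← transpose_mul, h, transpose_one]
  rw [fromBlocks_multiply, ← fromBlocks_one]
  simp [Matrix.mul_assoc, h']

theorem Phi_lyap {n m p : ℕ} {A : Matrix (Fin n) (Fin n) ℝ} {B : Matrix (Fin n) (Fin m) ℝ}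
    {C : Matrix (Fin p) (Fin n) ℝ} {f : Par n m p} (hf : f ∈ FSet A B C) :
    Lyap (Acl A B C (Phi A B C f)) := by
  obtain ⟨X, Y, M, F, H⟩ := f
  obtain ⟨hX, hY, hJ, hQ⟩ := hf
  simp only at hX hY hJ hQ
  have hu : IsUnit (1 - Y * X).det := isUnit_of_blocks' hX hY hJ
  set N := 1 - Y * X with hN
  have hN1 : Y * X + N = 1 := by rw [hN]; abel
  have hNN : N * N⁻¹ = 1 := mul_nonsing_inv _ hu
  set K := Phi A B C (X, Y, M, F, H) with hK
  set T := fromBlocks (1 : Matrix (Fin n) (Fin n) ℝ) Y (0 : Matrix (Fin n) (Fin n) ℝ) Nᵀ with hT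
  set S := fromBlocks (1 : Matrix (Fin n) (Fin n) ℝ) (-(Y * N⁻¹ᵀ)) (0 : Matrix (Fin n) (Fin n) ℝ) N⁻¹ᵀ with hS
  have hST : S * T = 1 := block_inv hNN
  have hTS : T * S = 1 := mul_eq_one_comm.1 hST
  have hST' : Sᵀ * Tᵀ = 1 := by rw [← transpose_mul, hTS, transpose_one]
  have i1 : Tᵀ * fromBlocks X 1 1 0 = fromBlocks X 1 1 Y := block_id1 hY hN1
  have i2 : Tᵀ * Acl A B C K * fromBlocks X 1 1 0 =
      fromBlocks (A * X + B * F) A M (Y * A + H * C) := by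
    rw [hT, block_id2 A B C K hY]
    have k1 : N * K.1 = M - Y * (A * X + B * F) - H * C * X := by
      simp only [hK, Phi]
      rw [← Matrix.mul_assoc, hNN, Matrix.one_mul]
    have k2 : N * K.2.1 = H := by
      simp only [hK, Phi]
      rw [← Matrix.mul_assoc, hNN, Matrix.one_mul]
    rw [k1, k2]
    have k3 : K.2.2 = F := rfl
    rw [k3]
    congr 1
    abel
  refine ⟨Sᵀ * fromBlocks X 1 1 Y * S, ?_, hJ.congr hTS, ?_⟩
  · have hJs : (fromBlocks X 1 1 Y)ᵀ = fromBlocks X 1 1 Y := by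
      rw [fromBlocks_transpose, hX, hY, transpose_one]
    rw [transpose_mul, transpose_mul, hJs, transpose_transpose, Matrix.mul_assoc]
  · have := hQ.congr hTS
    convert this using 1
    rw [← i2, ← i1, ← Matrix.mul_assoc Sᵀ, hST', Matrix.one_mul]
    rw [Matrix.mul_neg, Matrix.neg_mul, ← Matrix.mul_assoc Sᵀ, ← Matrix.mul_assoc Sᵀ, hST',
      Matrix.one_mul, Matrix.mul_assoc]

theorem exists_param_aux {n m p : ℕ} {A : Matrix (Fin n) (Fin n) ℝ} {B : Matrix (Fin n) (Fin m) ℝ}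
    {C : Matrix (Fin p) (Fin n) ℝ} (K : Ctl n m p) {X V : Matrix (Fin n) (Fin n) ℝ}
    (hX : Xᵀ = X) (hV : Vᵀ = V) (hP : QPos (fromBlocks X 1 1 V))
    (hQ : QPos (-(Acl A B C K * fromBlocks X 1 1 V))) : ∃ f ∈ FSet A B C, Phi A B C f = K := by
  have hu := isUnit_of_blocks hP
  set W := (1 - X * V)⁻¹ with hW
  have hW1 : (1 - X * V) * W = 1 := mul_nonsing_inv _ hu
  have hW2 : Wᵀ * (1 - V * X) = 1 := by
    have := congrArg transpose hW1
    simpa [transpose_mul, hX, hV] using this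
  have hW3 : (1 - V * X) * Wᵀ = 1 := mul_eq_one_comm.1 hW2
  have hVW : Wᵀ * V = V * W := by
    calc Wᵀ * V = Wᵀ * (V * ((1 - X * V) * W)) := by rw [hW1, mul_one]
      _ = (Wᵀ * (1 - V * X)) * V * W := by noncomm_ring
      _ = V * W := by rw [hW2, one_mul]
  set Y := -(V * W) with hYd
  have hY : Yᵀ = Y := by rw [hYd, transpose_neg, transpose_mul, hV, hVW]
  have hN1 : Y * X + Wᵀ = 1 := by
    rw [hYd, ← hVW]; rw [← hW2]; noncomm_ring
  have hsub : 1 - Y * X = Wᵀ := by rw [← hN1]; abel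
  have hinv : (1 - Y * X)⁻¹ = 1 - V * X := by
    rw [hsub]; exact inv_eq_right_inv hW2
  set T := fromBlocks (1 : Matrix (Fin n) (Fin n) ℝ) Y (0 : Matrix (Fin n) (Fin n) ℝ) Wᵀᵀ with hT
  have hST : fromBlocks (1 : Matrix (Fin n) (Fin n) ℝ) (-(Y * (1 - V * X)ᵀ)) (0 : Matrix (Fin n) (Fin n) ℝ) (1 - V * X)ᵀ * T = 1 := block_inv hW2
  have hPT : fromBlocks X 1 1 V * T = fromBlocks X 1 1 0 := by
    rw [hT, fromBlocks_multiply]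
    have : X * Y + W = 1 := by rw [hYd, ← hW1]; noncomm_ring
    have h2 : Y + V * W = 0 := by rw [hYd]; abel
    simp only [transpose_transpose, Matrix.mul_one, Matrix.mul_zero, add_zero, Matrix.one_mul,
      this, h2]
  have i1 : Tᵀ * fromBlocks X 1 1 V * T = fromBlocks X 1 1 Y := by
    rw [Matrix.mul_assoc, hPT]; exact block_id1 hY hN1
  have i2 : Tᵀ * (-(Acl A B C K * fromBlocks X 1 1 V)) * T = -(fromBlocks (A * X + B * K.2.2) A
        (Y * (A * X + B * K.2.2) + Wᵀ * K.2.1 * C * X + Wᵀ * K.1) (Y * A + Wᵀ * K.2.1 * C)) := by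
    rw [← block_id2 A B C K hY, Matrix.mul_neg, Matrix.neg_mul, ← hPT]
    simp only [Matrix.mul_assoc, hT]
  refine ⟨(X, Y, Y * (A * X + B * K.2.2) + Wᵀ * K.2.1 * C * X + Wᵀ * K.1, K.2.2, Wᵀ * K.2.1),
    ⟨hX, hY, ?_, ?_⟩, ?_⟩
  · have := hP.congr hST
    rw [i1] at this
    exact this
  · have := hQ.congr hST
    rw [i2] at this
    exact this
  · simp only [Phi]
    rw [hinv, ← Matrix.mul_assoc (1 - V * X) Wᵀ, hW3, Matrix.one_mul]
    have : Y * (A * X + B * K.2.2) + Wᵀ * K.2.1 * C * X + Wᵀ * K.1 - Y * (A * X + B * K.2.2)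
        - Wᵀ * K.2.1 * C * X = Wᵀ * K.1 := by abel
    rw [this, ← Matrix.mul_assoc, hW3, Matrix.one_mul]

theorem Acl_act {n m p : ℕ} (A : Matrix (Fin n) (Fin n) ℝ) (B : Matrix (Fin n) (Fin m) ℝ)
    (C : Matrix (Fin p) (Fin n) ℝ) (G : Matrix (Fin n) (Fin n) ℝ) (K : Ctl n m p) :
    Acl A B C (act G K) = fromBlocks 1 0 0 G * Acl A B C K * fromBlocks 1 0 0 G⁻¹ := by
  simp [Acl, act, fromBlocks_multiply, Matrix.mul_assoc]

theorem act_inv_mul {n : ℕ} {G : Matrix (Fin n) (Fin n) ℝ} (hG : IsUnit G.det) :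
    fromBlocks (1 : Matrix (Fin n) (Fin n) ℝ) 0 0 G⁻¹ *
      fromBlocks (1 : Matrix (Fin n) (Fin n) ℝ) 0 0 G = 1 := by
  rw [fromBlocks_multiply, ← fromBlocks_one]
  simp [nonsing_inv_mul _ hG]

theorem act_stable {n m p : ℕ} {A : Matrix (Fin n) (Fin n) ℝ} {B : Matrix (Fin n) (Fin m) ℝ}
    {C : Matrix (Fin p) (Fin n) ℝ} {f : Par n m p} (hf : f ∈ FSet A B C)
    {G : Matrix (Fin n) (Fin n) ℝ} (hG : IsUnit G.det) :
    IsStableMatrix (Acl A B C (act G (Phi A B C f))) := by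
  rw [stable_iff_lyap, Acl_act]
  exact (Phi_lyap hf).conj (act_inv_mul hG)

theorem exists_param {n m p : ℕ} {A : Matrix (Fin n) (Fin n) ℝ} {B : Matrix (Fin n) (Fin m) ℝ}
    {C : Matrix (Fin p) (Fin n) ℝ} (K : Ctl n m p) (hK : IsStableMatrix (Acl A B C K)) :
    ∃ (G : Matrix (Fin n) (Fin n) ℝ) (f : Par n m p), IsUnit G.det ∧ f ∈ FSet A B C ∧
      act G (Phi A B C f) = K := by
  obtain ⟨P, hPs, hP, hQ⟩ := stable_iff_lyap.1 hK
  set E : Matrix (Fin n ⊕ Fin n) (Fin n ⊕ Fin n) ℝ := fromBlocks 0 1 1 0 with hE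
  have hEs : Eᵀ = E := by simp [hE, fromBlocks_transpose]
  have c1 : ∀ᶠ ε : ℝ in nhdsWithin 0 (Set.Ioi 0), QPos (P + ε • E) := by
    have hc : Continuous fun ε : ℝ => P + ε • E := by fun_prop
    exact (hc.continuousAt.eventually (by simpa using hP.eventually)).filter_mono
      nhdsWithin_le_nhds
  have c2 : ∀ᶠ ε : ℝ in nhdsWithin 0 (Set.Ioi 0), QPos (-(Acl A B C K * (P + ε • E))) := by
    have hc : Continuous fun ε : ℝ => -(Acl A B C K * (P + ε • E)) := by fun_prop
    exact (hc.continuousAt.eventually (by simpa using hQ.eventually)).filter_mono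
      nhdsWithin_le_nhds
  have c3 : ∀ᶠ ε : ℝ in nhdsWithin 0 (Set.Ioi 0), ∀ z ∈ spectrum ℝ (-P.toBlocks₂₁), ε ≠ z := by
    rw [(Matrix.finite_spectrum (-P.toBlocks₂₁)).eventually_all]
    intro z _
    by_cases hz : z = 0
    · subst hz
      filter_upwards [self_mem_nhdsWithin] with ε hε
      exact ne_of_gt hε
    · exact (eventually_ne_nhds (Ne.symm hz)).filter_mono nhdsWithin_le_nhds
  obtain ⟨ε, d1, d2, d3⟩ := (c1.and (c2.and c3)).exists
  set R := P + ε • E with hR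
  have hRs : Rᵀ = R := by rw [hR, transpose_add, transpose_smul, hPs, hEs]
  set X := R.toBlocks₁₁ with hX
  set G := R.toBlocks₂₁ with hG
  set V := R.toBlocks₂₂ with hV
  have hXs : Xᵀ = X := by ext i j; exact congrFun (congrFun hRs (Sum.inl i)) (Sum.inl j)
  have hVs : Vᵀ = V := by ext i j; exact congrFun (congrFun hRs (Sum.inr i)) (Sum.inr j)
  have hU : R.toBlocks₁₂ = Gᵀ := by
    ext i j; exact congrFun (congrFun hRs.symm (Sum.inl i)) (Sum.inr j)
  have hRb : R = fromBlocks X Gᵀ G V := by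
    rw [← hU, hX, hG, hV, fromBlocks_toBlocks]
  have hGe : G = ε • 1 + P.toBlocks₂₁ := by
    ext i j
    simp [hG, hR, hE, toBlocks₂₁, add_comm]
  have hGu : IsUnit G.det := by
    have : ε ∉ spectrum ℝ (-P.toBlocks₂₁) := fun h => d3 ε h rfl
    rw [spectrum.mem_iff, not_not, Algebra.algebraMap_eq_smul_one, sub_neg_eq_add, ← hGe,
      isUnit_iff_isUnit_det] at this
    exact this
  have hGG : G * G⁻¹ = 1 := mul_nonsing_inv _ hGu
  have hGG' : G⁻¹ * G = 1 := nonsing_inv_mul _ hGu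
  have hGu' : IsUnit (G⁻¹).det := isUnit_nonsing_inv_det _ hGu
  have hGii : (G⁻¹)⁻¹ = G := nonsing_inv_nonsing_inv _ hGu
  set T : Matrix (Fin n ⊕ Fin n) (Fin n ⊕ Fin n) ℝ := fromBlocks 1 0 0 G⁻¹ with hT
  set S : Matrix (Fin n ⊕ Fin n) (Fin n ⊕ Fin n) ℝ := fromBlocks 1 0 0 G with hS
  have hTS : T * S = 1 := act_inv_mul hGu
  have hST : S * T = 1 := mul_eq_one_comm.1 hTS
  have hST' : Sᵀ * Tᵀ = 1 := by rw [← transpose_mul, hTS, transpose_one]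
  have hRT : T * R * Tᵀ = fromBlocks X 1 1 (G⁻¹ * V * G⁻¹ᵀ) := by
    have : Gᵀ * G⁻¹ᵀ = 1 := by rw [← transpose_mul, hGG', transpose_one]
    rw [hRb, hT, fromBlocks_transpose, fromBlocks_multiply, fromBlocks_multiply]
    simp only [transpose_one, transpose_zero, Matrix.one_mul, Matrix.zero_mul, Matrix.mul_zero,
      Matrix.mul_one, add_zero, zero_add, this, hGG']
  obtain ⟨f, hf, hfK⟩ := exists_param_aux (A := A) (B := B) (C := C) (act G⁻¹ K) (X := X)
    (V := G⁻¹ * V * G⁻¹ᵀ) hXs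
    (by rw [transpose_mul, transpose_mul, transpose_transpose, hVs, Matrix.mul_assoc])
    (by rw [← hRT]; simpa using d1.congr (T := Tᵀ) hST')
    (by
      rw [← hRT, Acl_act, hGii]
      have := d2.congr (T := Tᵀ) hST'
      convert this using 1
      calc -(T * Acl A B C K * S * (T * R * Tᵀ)) = -(T * Acl A B C K * (S * T) * R * Tᵀ) := by
            simp only [Matrix.mul_assoc]
        _ = _ := by
            rw [hST, transpose_transpose, Matrix.mul_one]
            simp only [Matrix.mul_neg, Matrix.neg_mul, Matrix.mul_assoc])
  refine ⟨G, f, hGu, hf, ?_⟩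
  rw [hfK]
  simp only [act, hGii]
  refine Prod.ext ?_ (Prod.ext ?_ ?_)
  · calc G * (G⁻¹ * K.1 * G) * G⁻¹ = (G * G⁻¹) * K.1 * (G * G⁻¹) := by noncomm_ring
      _ = K.1 := by rw [hGG, one_mul, mul_one]
  · simp only; rw [← Matrix.mul_assoc, hGG, Matrix.one_mul]
  · simp only; rw [Matrix.mul_assoc, hGG, Matrix.mul_one]

theorem QPos.transpose {k : Type*} [Fintype k] {M : Matrix k k ℝ} (h : QPos M) : QPos Mᵀ := by
  intro x hx
  have := h x hx
  rwa [mulVec_transpose, dotProduct_comm, ← dotProduct_mulVec]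

theorem dot_blocks {n : ℕ} (P Q R S : Matrix (Fin n) (Fin n) ℝ) (x : Fin n ⊕ Fin n → ℝ) :
    x ⬝ᵥ (fromBlocks P Q R S *ᵥ x) =
      (x ∘ Sum.inl) ⬝ᵥ (P *ᵥ (x ∘ Sum.inl)) + (x ∘ Sum.inl) ⬝ᵥ (Q *ᵥ (x ∘ Sum.inr)) +
      ((x ∘ Sum.inr) ⬝ᵥ (R *ᵥ (x ∘ Sum.inl)) + (x ∘ Sum.inr) ⬝ᵥ (S *ᵥ (x ∘ Sum.inr))) := by
  rw [fromBlocks_mulVec, ← dotProduct_add, ← dotProduct_add]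
  simp [dotProduct, Fintype.sum_sum_type]

theorem QPos.blocks {n : ℕ} {P S : Matrix (Fin n) (Fin n) ℝ} (hP : QPos P) (hS : QPos S)
    (Q : Matrix (Fin n) (Fin n) ℝ) : QPos (fromBlocks P Q (-Qᵀ) S) := by
  intro x hx
  have key : (x ∘ Sum.inr) ⬝ᵥ (-Qᵀ *ᵥ (x ∘ Sum.inl)) =
      -((x ∘ Sum.inl) ⬝ᵥ (Q *ᵥ (x ∘ Sum.inr))) := by
    rw [neg_mulVec, dotProduct_neg, mulVec_transpose, dotProduct_comm, ← dotProduct_mulVec]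
  rw [dot_blocks, key]
  have nn : ∀ {M : Matrix (Fin n) (Fin n) ℝ}, QPos M → ∀ y, 0 ≤ y ⬝ᵥ (M *ᵥ y) := by
    intro M hM y
    by_cases hy : y = 0
    · simp [hy]
    · exact (hM y hy).le
  by_cases h1 : x ∘ Sum.inl = 0
  · have h2 : x ∘ Sum.inr ≠ 0 := by
      intro h2
      apply hx
      ext i
      rcases i with i | i
      · exact congrFun h1 i
      · exact congrFun h2 i
    linarith [nn hP (x ∘ Sum.inl), hS _ h2]
  · linarith [nn hS (x ∘ Sum.inr), hP _ h1]

theorem FSet.nonempty {n m p : ℕ} {A : Matrix (Fin n) (Fin n) ℝ} {B : Matrix (Fin n) (Fin m) ℝ}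
    {C : Matrix (Fin p) (Fin n) ℝ} (hctrb : Controllable A B) (hobs : Controllable Aᵀ Cᵀ) :
    (FSet A B C).Nonempty := by
  obtain ⟨X, F, hX, hXp, hXq⟩ := ctrb_lmi hctrb
  obtain ⟨Y, H, hY, hYp, hYq⟩ := ctrb_lmi hobs
  have hYq' := hYq.transpose
  rw [transpose_neg, transpose_add, transpose_mul, transpose_mul, transpose_transpose,
    transpose_transpose, hY] at hYq'
  have h0 : QPos (fromBlocks X 0 0 Y) := by simpa using QPos.blocks hXp hYp 0
  have c1 : ∀ᶠ ε : ℝ in nhdsWithin 0 (Set.Ioi 0),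
      QPos (fromBlocks X (ε • (1 : Matrix (Fin n) (Fin n) ℝ)) (ε • (1 : Matrix (Fin n) (Fin n) ℝ))
        Y) := by
    have hc : Continuous fun ε : ℝ => fromBlocks X (ε • (1 : Matrix (Fin n) (Fin n) ℝ))
        (ε • (1 : Matrix (Fin n) (Fin n) ℝ)) Y := by fun_prop
    exact (hc.continuousAt.eventually (by simpa using h0.eventually)).filter_mono
      nhdsWithin_le_nhds
  obtain ⟨ε, h1, hε⟩ := (c1.and self_mem_nhdsWithin).exists
  have hε : 0 < ε := hε
  have ht : 0 < ε⁻¹ := inv_pos.2 hε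
  refine ⟨(ε⁻¹ • X, ε⁻¹ • Y, -Aᵀ, ε⁻¹ • F, ε⁻¹ • Hᵀ), ?_, ?_, ?_, ?_⟩
  · simp [hX]
  · simp [hY]
  · have := h1.smul ht
    rw [fromBlocks_smul, smul_smul, inv_mul_cancel₀ hε.ne', one_smul] at this
    exact this
  · have e1 : A * (ε⁻¹ • X) + B * (ε⁻¹ • F) = ε⁻¹ • (A * X + B * F) := by
      rw [Matrix.mul_smul, Matrix.mul_smul, smul_add]
    have e2 : (ε⁻¹ • Y) * A + (ε⁻¹ • Hᵀ) * C = ε⁻¹ • (Y * A + Hᵀ * C) := by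
      rw [Matrix.smul_mul, Matrix.smul_mul, smul_add]
    simp only
    rw [e1, e2, fromBlocks_neg, ← smul_neg, ← smul_neg]
    have := QPos.blocks (hXq.smul ht) (hYq'.smul ht) (-A)
    rwa [transpose_neg] at this

theorem continuousAt_inv_of_isUnit {n : ℕ} {G : Matrix (Fin n) (Fin n) ℝ} (hG : IsUnit G.det) :
    ContinuousAt (fun M : Matrix (Fin n) (Fin n) ℝ => M⁻¹) G := by
  refine continuousAt_matrix_inv G ?_
  have : (Ring.inverse : ℝ → ℝ) = Inv.inv := by
    funext x; exact Ring.inverse_eq_inv x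
  rw [this]
  exact continuousAt_inv₀ hG.ne_zero

theorem continuousOn_act_Phi {n m p : ℕ} (A : Matrix (Fin n) (Fin n) ℝ)
    (B : Matrix (Fin n) (Fin m) ℝ) (C : Matrix (Fin p) (Fin n) ℝ) :
    ContinuousOn (fun z : Matrix (Fin n) (Fin n) ℝ × Par n m p => act z.1 (Phi A B C z.2))
      ({G | IsUnit G.det} ×ˢ FSet A B C) := by
  rintro ⟨G, f⟩ ⟨hG, hf⟩
  apply ContinuousAt.continuousWithinAt
  have h1 : ContinuousAt (fun z : Matrix (Fin n) (Fin n) ℝ × Par n m p => z.1⁻¹) (G, f) :=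
    ContinuousAt.comp (f := Prod.fst) (g := fun M : Matrix (Fin n) (Fin n) ℝ => M⁻¹)
      (continuousAt_inv_of_isUnit hG) continuousAt_fst
  have hc : Continuous fun z : Matrix (Fin n) (Fin n) ℝ × Par n m p => 1 - z.2.2.1 * z.2.1 := by
    fun_prop
  have h2 : ContinuousAt (fun z : Matrix (Fin n) (Fin n) ℝ × Par n m p =>
      (1 - z.2.2.1 * z.2.1)⁻¹) (G, f) :=
    ContinuousAt.comp (f := fun z : Matrix (Fin n) (Fin n) ℝ × Par n m p => 1 - z.2.2.1 * z.2.1)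
      (g := fun M : Matrix (Fin n) (Fin n) ℝ => M⁻¹)
      (continuousAt_inv_of_isUnit (isUnit_of_blocks' hf.1 hf.2.1 hf.2.2.1)) hc.continuousAt
  simp only [act, Phi]
  have mul : ∀ {a b c : ℕ} {u : Matrix (Fin n) (Fin n) ℝ × Par n m p → Matrix (Fin a) (Fin b) ℝ}
      {v : Matrix (Fin n) (Fin n) ℝ × Par n m p → Matrix (Fin b) (Fin c) ℝ} {z},
      ContinuousAt u z → ContinuousAt v z → ContinuousAt (fun w => u w * v w) z := by
    intro a b c u v z hu hv
    exact ((continuous_fst.matrix_mul continuous_snd).continuousAt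
      (x := (u z, v z))).comp (f := fun w => (u w, v w)) (hu.prodMk hv)
  refine ContinuousAt.prodMk ?_ (ContinuousAt.prodMk ?_ ?_)
  · refine mul (mul continuousAt_fst (mul h2 ?_)) h1
    apply Continuous.continuousAt
    fun_prop
  · refine mul continuousAt_fst (mul h2 ?_)
    apply Continuous.continuousAt
    fun_prop
  · refine mul ?_ h1
    apply Continuous.continuousAt
    fun_prop

/-- If `(A, B)` is controllable and `(C, A)` is observable, then the set
`𝒞_n` of full-order stabilizing controllers has at most two path-connected components:
it is the union of two nonempty path-connected subsets. -/
theorem Cn_at_most_two_components (n m p : ℕ) (hn : 0 < n) (hm : 0 < m) (hp : 0 < p)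
    (A : Matrix (Fin n) (Fin n) ℝ) (B : Matrix (Fin n) (Fin m) ℝ)
    (C : Matrix (Fin p) (Fin n) ℝ)
    (hctrb : Controllable A B) (hobs : Controllable Aᵀ Cᵀ) :
    ∃ S₁ S₂ : Set (Matrix (Fin n) (Fin n) ℝ × Matrix (Fin n) (Fin p) ℝ ×
        Matrix (Fin m) (Fin n) ℝ),
      S₁.Nonempty ∧ S₂.Nonempty ∧ IsPathConnected S₁ ∧ IsPathConnected S₂ ∧
      {K | IsStableMatrix (Acl A B C K)} = S₁ ∪ S₂ := by
  have hne := FSet.nonempty hctrb hobs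
  have hF : IsPathConnected (FSet A B C) := (FSet.convex A B C).isPathConnected hne
  have hcont := continuousOn_act_Phi A B C
  have h1 : IsPathConnected ((fun z : Matrix (Fin n) (Fin n) ℝ × Par n m p =>
      act z.1 (Phi A B C z.2)) '' ({G | 0 < G.det} ×ˢ FSet A B C)) :=
    (pc_pos.prod hF).image' (hcont.mono (Set.prod_mono
      (fun G (hG : 0 < G.det) => isUnit_iff_ne_zero.2 hG.ne') subset_rfl))
  have h2 : IsPathConnected ((fun z : Matrix (Fin n) (Fin n) ℝ × Par n m p =>
      act z.1 (Phi A B C z.2)) '' ({G | G.det < 0} ×ˢ FSet A B C)) :=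
    ((pc_neg hn).prod hF).image' (hcont.mono (Set.prod_mono
      (fun G (hG : G.det < 0) => isUnit_iff_ne_zero.2 hG.ne) subset_rfl))
  refine ⟨_, _, h1.nonempty, h2.nonempty, h1, h2, ?_⟩
  ext K
  constructor
  · intro hK
    obtain ⟨G, f, hG, hf, rfl⟩ := exists_param K hK
    rcases lt_or_gt_of_ne (isUnit_iff_ne_zero.1 hG) with h | h
    · exact Or.inr ⟨(G, f), ⟨h, hf⟩, rfl⟩
    · exact Or.inl ⟨(G, f), ⟨h, hf⟩, rfl⟩
  · rintro (⟨⟨G, f⟩, ⟨hG, hf⟩, rfl⟩ | ⟨⟨G, f⟩, ⟨hG, hf⟩, rfl⟩)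
    · exact act_stable hf (isUnit_iff_ne_zero.2 (ne_of_gt hG))
    · exact act_stable hf (isUnit_iff_ne_zero.2 (ne_of_lt hG))
end
end

section
/- Assume (A, B) is controllable, (C, A) is observable, and 𝒞_n is not path-connected. Then for every invertible T ∈ ℝ^{n×n} with det T < 0 and every K ∈ 𝒞_n: (i) 𝒯(T, K) does not lie in the path component of K within 𝒞_n; (ii) the map K' ↦ 𝒯(T, K') maps the path component of K within 𝒞_n bijectively onto the path component of 𝒯(T, K) within 𝒞_n, and is a homeomorphism between these two components; (iii) every element of 𝒞_n lies either in the path component of K or in the path component of 𝒯(T, K). In particular, 𝒞_n has exactly two path-connected components and they are mapped onto each other by the similarity transformation 𝒯(T, ·). -/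
open Matrix

noncomputable section

/-- The set of full-order stabilizing controllers `𝒞_n`. -/
def Cn {n m p : ℕ} (A : Matrix (Fin n) (Fin n) ℝ) (B : Matrix (Fin n) (Fin m) ℝ)
    (C : Matrix (Fin p) (Fin n) ℝ) :
    Set (Matrix (Fin n) (Fin n) ℝ × Matrix (Fin n) (Fin p) ℝ × Matrix (Fin m) (Fin n) ℝ) :=
  {K | IsStableMatrix (Acl A B C K)}

/-- Similarity transformation of a controller:
`𝒯(T, (A_K, B_K, C_K)) = (T A_K T⁻¹, T B_K, C_K T⁻¹)`. -/
def simT {m p n : ℕ} (T : Matrix (Fin n) (Fin n) ℝ)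
    (K : Matrix (Fin n) (Fin n) ℝ × Matrix (Fin n) (Fin p) ℝ × Matrix (Fin m) (Fin n) ℝ) :
    Matrix (Fin n) (Fin n) ℝ × Matrix (Fin n) (Fin p) ℝ × Matrix (Fin m) (Fin n) ℝ :=
  (T * K.1 * T⁻¹, T * K.2.1, K.2.2 * T⁻¹)


/-- `M` is joined to the identity inside the matrices of positive determinant. -/
def GLJ {n : ℕ} (M : Matrix (Fin n) (Fin n) ℝ) : Prop :=
  JoinedIn {N : Matrix (Fin n) (Fin n) ℝ | 0 < N.det} 1 M

def DD {n : ℕ} (i : Fin n) (d : ℝ) : Matrix (Fin n) (Fin n) ℝ :=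
  diagonal (Function.update 1 i d)

lemma DD_det {n : ℕ} (i : Fin n) (d : ℝ) : (DD i d).det = d := by
  rw [DD, det_diagonal]
  simp [Finset.prod_update_of_mem]

lemma DD_eq {n : ℕ} (i : Fin n) (d : ℝ) : DD i d = 1 + single i i (d - 1) := by
  ext a b
  simp only [DD, diagonal_apply, Function.update_apply, Matrix.add_apply, one_apply, single_apply,
    Pi.one_apply]
  by_cases h1 : a = b
  · subst h1
    by_cases h2 : a = i
    · subst h2; simp
    · simp [h2, Ne.symm h2]
  · have : ¬ (i = a ∧ i = b) := fun h => h1 (h.1.symm.trans h.2)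
    simp [h1, this]

lemma DD_mul {n : ℕ} (i : Fin n) (d e : ℝ) : DD i d * DD i e = DD i (d * e) := by
  rw [DD, DD, DD, diagonal_mul_diagonal]
  congr 1
  ext k
  by_cases h : k = i
  · subst h; simp
  · simp [h]

lemma DD_one {n : ℕ} (i : Fin n) : DD i 1 = 1 := by
  rw [DD_eq]; simp

lemma GLJ_one {n : ℕ} : GLJ (1 : Matrix (Fin n) (Fin n) ℝ) :=
  JoinedIn.refl (by simp)

lemma GLJ.det_pos {n : ℕ} {M : Matrix (Fin n) (Fin n) ℝ} (h : GLJ M) : 0 < M.det :=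
  h.target_mem

lemma GLJ.mul {n : ℕ} {M N : Matrix (Fin n) (Fin n) ℝ} (hM : GLJ M) (hN : GLJ N) :
    GLJ (M * N) := by
  have h := JoinedIn.mul hM hN
  rw [one_mul] at h
  refine h.mono ?_
  rintro _ ⟨a, ha, b, hb, rfl⟩
  simp only [Set.mem_ofPred_eq, det_mul] at *
  exact mul_pos ha hb

lemma GLJ.conj {n : ℕ} {M : Matrix (Fin n) (Fin n) ℝ} (hM : GLJ M)
    {R : Matrix (Fin n) (Fin n) ℝ} (hR : R * R = 1) : GLJ (R * M * R) := by
  have h := JoinedIn.map hM (f := fun N => R * N * R) (by fun_prop)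
  simp only [mul_one, hR] at h
  refine h.mono ?_
  rintro _ ⟨a, ha, rfl⟩
  have h2 : R.det * R.det = 1 := by rw [← det_mul, hR, det_one]
  simp only [Set.mem_ofPred_eq, det_mul] at *
  calc (0:ℝ) < a.det := ha
    _ = (R.det * R.det) * a.det := by rw [h2, one_mul]
    _ = _ := by ring

lemma GLJ_transvection {n : ℕ} {i j : Fin n} (hij : i ≠ j) (c : ℝ) :
    GLJ (transvection i j c) := by
  refine JoinedIn.ofLine (f := fun t : ℝ => transvection i j (t * c)) ?_ (by simp) (by simp) ?_
  · apply Continuous.continuousOn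
    unfold transvection
    have : ∀ t : ℝ, single i j (t * c) = t • single i j c := by
      intro t; rw [smul_single]; rfl
    simp only [this]
    fun_prop
  · rintro _ ⟨t, -, rfl⟩
    simp [det_transvection_of_ne i j hij]

lemma GLJ_DD_pos {n : ℕ} (i : Fin n) {d : ℝ} (hd : 0 < d) : GLJ (DD i d) := by
  refine JoinedIn.ofLine (f := fun t : ℝ => DD i (1 + t * (d - 1))) ?_
    (by simp [DD_one]) (by simp) ?_
  · apply Continuous.continuousOn
    have : ∀ t : ℝ, DD i (1 + t * (d - 1)) = 1 + t • single i i (d - 1) := by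
      intro t; rw [DD_eq, smul_single]; simp
    simp only [this]
    fun_prop
  · rintro _ ⟨t, ht, rfl⟩
    simp only [Set.mem_ofPred_eq, DD_det]
    obtain ⟨h0, h1⟩ := ht
    rcases eq_or_lt_of_le h1 with h | h
    · subst h; linarith
    · nlinarith [mul_nonneg h0 hd.le]

lemma GLJ_DD_DD {n : ℕ} (i j : Fin n) : GLJ (DD i (-1) * DD j (-1)) := by
  by_cases hij : i = j
  · subst hij
    rw [DD_mul]; norm_num [DD_one, GLJ_one]
  · have hji : j ≠ i := Ne.symm hij
    have hW := ((GLJ_transvection hij 1).mul (GLJ_transvection hji (-1))).mul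
      (GLJ_transvection hij 1)
    have h := hW.mul hW
    convert h using 1
    rw [DD_eq, DD_eq]
    have e1 : (single i i (-1 - 1) : Matrix (Fin n) (Fin n) ℝ) = (-2 : ℝ) • single i i 1 := by
      rw [smul_single]; norm_num
    have e2 : (single j j (-1 - 1) : Matrix (Fin n) (Fin n) ℝ) = (-2 : ℝ) • single j j 1 := by
      rw [smul_single]; norm_num
    have e3 : (single j i (-1) : Matrix (Fin n) (Fin n) ℝ) = - single j i 1 := by
      rw [← single_neg]
    unfold transvection
    rw [e1, e2, e3]
    simp only [mul_add, add_mul, mul_one, one_mul, neg_mul, mul_neg, smul_mul_assoc, mul_smul_comm,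
      single_mul_single_same, single_mul_single_of_ne _ _ _ _ hij,
      single_mul_single_of_ne _ _ _ _ hji, neg_neg, smul_zero, neg_zero, mul_zero, zero_mul]
    module

lemma GLJ_or {n : ℕ} (i0 : Fin n) (M : Matrix (Fin n) (Fin n) ℝ) (hM : M.det ≠ 0) :
    GLJ M ∨ GLJ (DD i0 (-1) * M) := by
  have hR : DD i0 (-1) * DD i0 (-1) = 1 := by rw [DD_mul]; norm_num [DD_one]
  have hmul : ∀ A B : Matrix (Fin n) (Fin n) ℝ, (GLJ A ∨ GLJ (DD i0 (-1) * A)) →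
      (GLJ B ∨ GLJ (DD i0 (-1) * B)) → (GLJ (A * B) ∨ GLJ (DD i0 (-1) * (A * B))) := by
    set R := DD i0 (-1)
    rintro A B (hA | hA) (hB | hB)
    · exact Or.inl (hA.mul hB)
    · right
      have := (hA.conj hR).mul hB
      convert this using 1
      simp only [mul_assoc]
      rw [← mul_assoc R R B, hR, one_mul]
    · right
      rw [← mul_assoc]
      exact hA.mul hB
    · left
      have := (hA.conj hR).mul hB
      convert this using 1
      simp only [mul_assoc]
      rw [← mul_assoc R R B, hR, one_mul, ← mul_assoc R R, hR, one_mul]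
  have hdd : ∀ i d, d ≠ 0 → (GLJ (DD i d) ∨ GLJ (DD i0 (-1) * DD i d)) := by
    intro i d hd
    rcases lt_or_gt_of_ne hd with h | h
    · right
      have h1 := (GLJ_DD_DD i0 i).mul (GLJ_DD_pos i (d := -d) (by linarith))
      rwa [mul_assoc, DD_mul, neg_one_mul, neg_neg] at h1
    · exact Or.inl (GLJ_DD_pos i h)
  refine diagonal_transvection_induction_of_det_ne_zero
    (fun M => GLJ M ∨ GLJ (DD i0 (-1) * M)) M hM ?_ ?_ ?_
  · intro D hD
    rw [det_diagonal, Finset.prod_ne_zero_iff] at hD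
    have key : ∀ s : Finset (Fin n),
        (GLJ (diagonal (fun k => if k ∈ s then D k else 1)) ∨
          GLJ (DD i0 (-1) * diagonal (fun k => if k ∈ s then D k else 1))) := by
      intro s
      induction s using Finset.induction_on with
      | empty => left; simpa using GLJ_one
      | insert a s ha ih =>
        have := hmul _ _ (hdd a (D a) (hD a (Finset.mem_univ a))) ih
        convert this using 3
        all_goals
          rw [DD, diagonal_mul_diagonal]
          congr 1
          ext k
          by_cases h : k = a
          · subst h; simp [ha]
          · simp [h]
    simpa using key Finset.univ
  · rintro ⟨i, j, hij, c⟩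
    exact Or.inl (GLJ_transvection hij c)
  · intro A B _ _
    exact hmul A B

lemma GLJ_of_det_pos {n : ℕ} (hn : 0 < n) (M : Matrix (Fin n) (Fin n) ℝ) (hM : 0 < M.det) :
    GLJ M := by
  rcases GLJ_or ⟨0, hn⟩ M hM.ne' with h | h
  · exact h
  · have := h.det_pos
    rw [det_mul, DD_det] at this
    linarith

/-- Positive definiteness of the quadratic form of a (not necessarily symmetric) matrix. -/
def QP {k : Type*} [Fintype k] (M : Matrix k k ℝ) : Prop :=
  ∀ x : k → ℝ, x ≠ 0 → 0 < x ⬝ᵥ (M *ᵥ x)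

lemma quad_congr {k : Type*} [Fintype k] (M J : Matrix k k ℝ) (x y : k → ℝ) :
    x ⬝ᵥ ((Jᵀ * M * J) *ᵥ y) = (J *ᵥ x) ⬝ᵥ (M *ᵥ (J *ᵥ y)) := by
  rw [← mulVec_mulVec, ← mulVec_mulVec, dotProduct_mulVec x Jᵀ, vecMul_transpose]

lemma QP.congr {k : Type*} [Fintype k] [DecidableEq k] {M : Matrix k k ℝ} (h : QP M)
    (J : Matrix k k ℝ) (hJ : IsUnit J.det) : QP (Jᵀ * M * J) := by
  intro x hx
  rw [quad_congr]
  apply h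
  intro h0
  apply hx
  exact (mulVec_injective_iff_isUnit.2 ((isUnit_iff_isUnit_det J).2 hJ)) (by simpa using h0)

lemma QP.of_congr {k : Type*} [Fintype k] [DecidableEq k] {M : Matrix k k ℝ}
    (J : Matrix k k ℝ) (hJ : IsUnit J.det) (h : QP (Jᵀ * M * J)) : QP M := by
  have h2 := h.congr J⁻¹ (isUnit_nonsing_inv_det J hJ)
  have e : (J⁻¹)ᵀ * (Jᵀ * M * J) * J⁻¹ = ((J⁻¹)ᵀ * Jᵀ) * M * (J * J⁻¹) := by
    simp only [mul_assoc]
  rw [e, ← transpose_mul, mul_nonsing_inv _ hJ] at h2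
  simpa using h2

lemma dot_symm {k : Type*} [Fintype k] {P : Matrix k k ℝ} (hP : Pᵀ = P) (x y : k → ℝ) :
    x ⬝ᵥ (P *ᵥ y) = y ⬝ᵥ (P *ᵥ x) := by
  rw [dotProduct_mulVec, dotProduct_comm, ← mulVec_transpose, hP]

lemma stable_of_lyap {k : Type*} [Fintype k] [DecidableEq k] (M P : Matrix k k ℝ)
    (hs : Pᵀ = P) (hP : QP P) (hMP : QP (-(M * P))) : IsStableMatrix M := by
  intro μ hμ
  rw [spectrum.mem_iff, isUnit_iff_isUnit_det, isUnit_iff_ne_zero, not_not] at hμ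
  obtain ⟨v, hv0, hv⟩ := exists_vecMul_eq_zero_iff.2 hμ
  set a : k → ℝ := fun i => (v i).re with ha
  set b : k → ℝ := fun i => (v i).im with hb
  have hv' : v ᵥ* (M.map (algebraMap ℝ ℂ)) = μ • v := by
    rw [vecMul_sub, sub_eq_zero, algebraMap_eq_diagonal] at hv
    rw [← hv]
    ext j
    simp [vecMul_diagonal, mul_comm]
  have ea : a ᵥ* M = μ.re • a - μ.im • b := by
    ext j
    have := congrArg Complex.re (congrFun hv' j)
    simpa [vecMul, dotProduct, ha, hb] using this
  have eb : b ᵥ* M = μ.im • a + μ.re • b := by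
    ext j
    have := congrArg Complex.im (congrFun hv' j)
    simp [vecMul, dotProduct, ha, hb] at this ⊢
    linarith
  have sa : a ⬝ᵥ ((M * P) *ᵥ a) = μ.re * (a ⬝ᵥ (P *ᵥ a)) - μ.im * (b ⬝ᵥ (P *ᵥ a)) := by
    rw [← mulVec_mulVec, dotProduct_mulVec, ea, sub_dotProduct, smul_dotProduct, smul_dotProduct]
    simp
  have sb : b ⬝ᵥ ((M * P) *ᵥ b) = μ.im * (a ⬝ᵥ (P *ᵥ b)) + μ.re * (b ⬝ᵥ (P *ᵥ b)) := by
    rw [← mulVec_mulVec, dotProduct_mulVec, eb, add_dotProduct, smul_dotProduct, smul_dotProduct]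
    simp
  rw [dot_symm hs a b] at sb
  have hne : a ≠ 0 ∨ b ≠ 0 := by
    by_contra! h
    apply hv0
    ext i
    apply Complex.ext
    · exact congrFun h.1 i
    · exact congrFun h.2 i
  have nP : ∀ x : k → ℝ, 0 ≤ x ⬝ᵥ (P *ᵥ x) := by
    intro x
    by_cases h : x = 0
    · simp [h]
    · exact (hP x h).le
  have nM : ∀ x : k → ℝ, x ⬝ᵥ ((M * P) *ᵥ x) ≤ 0 := by
    intro x
    by_cases h : x = 0
    · simp [h]
    · have := hMP x h
      rw [neg_mulVec, dotProduct_neg] at this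
      linarith
  have nM' : ∀ x : k → ℝ, x ≠ 0 → x ⬝ᵥ ((M * P) *ᵥ x) < 0 := by
    intro x h
    have := hMP x h
    rw [neg_mulVec, dotProduct_neg] at this
    linarith
  have h1 := nP a
  have h2 := nP b
  have h3 : a ⬝ᵥ ((M * P) *ᵥ a) + b ⬝ᵥ ((M * P) *ᵥ b) < 0 := by
    rcases hne with h | h
    · linarith [nM' a h, nM b]
    · linarith [nM' b h, nM a]
  by_contra! hc
  nlinarith [mul_nonneg hc h1, mul_nonneg hc h2]

open scoped Matrix.Norms.L2Operator in
lemma exists_pow_norm_lt {k : Type*} [Fintype k] [DecidableEq k] [Nonempty k]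
    (S : Matrix k k ℂ) (hS : ∀ μ ∈ spectrum ℂ S, ‖μ‖ < 1) :
    ∃ N : ℕ, 0 < N ∧ ‖S ^ N‖ < 1 := by
  have h1 : spectralRadius ℂ S < (1 : NNReal) :=
    spectrum.spectralRadius_lt_of_forall_lt S (fun μ hμ => by exact_mod_cast hS μ hμ)
  have h2 := spectrum.pow_nnnorm_pow_one_div_tendsto_nhds_spectralRadius S
  have h3 := (h2.eventually (gt_mem_nhds h1)).and (Filter.eventually_gt_atTop 0)
  obtain ⟨N, hN, hN0⟩ := h3.exists
  refine ⟨N, hN0, ?_⟩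
  by_contra! hc
  have hc' : (1 : ENNReal) ≤ (‖S ^ N‖₊ : ENNReal) := by exact_mod_cast hc
  have := ENNReal.one_le_rpow hc' (z := 1 / (N : ℝ)) (by positivity)
  exact absurd hN (not_lt.2 (by exact_mod_cast this))

open scoped Matrix.Norms.L2Operator in
lemma dot_lt_of_norm {k : Type*} [Fintype k] [DecidableEq k] (S : Matrix k k ℝ)
    (hS : ‖S.map (algebraMap ℝ ℂ)‖ < 1) (x : k → ℝ) (hx : x ≠ 0) :
    (Sᵀ *ᵥ x) ⬝ᵥ (Sᵀ *ᵥ x) < x ⬝ᵥ x := by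
  have h := l2_opNorm_mulVec ((S.map (algebraMap ℝ ℂ))ᴴ) (WithLp.toLp 2 (fun i => (x i : ℂ)))
  rw [l2_opNorm_conjTranspose] at h
  have e : ∀ y : k → ℝ, ‖WithLp.toLp 2 (fun i => (y i : ℂ))‖ ^ 2 = y ⬝ᵥ y := by
    intro y
    rw [EuclideanSpace.norm_sq_eq]
    simp [dotProduct, pow_two]
  have e2 : ((S.map (algebraMap ℝ ℂ))ᴴ *ᵥ (fun i => (x i : ℂ))) =
      fun i => (((Sᵀ *ᵥ x) i : ℝ) : ℂ) := by
    ext i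
    simp [mulVec, dotProduct]
  have h' : ‖WithLp.toLp 2 (fun i => (((Sᵀ *ᵥ x) i : ℝ) : ℂ))‖ ≤
      ‖S.map (algebraMap ℝ ℂ)‖ * ‖WithLp.toLp 2 (fun i => (x i : ℂ))‖ := by
    rw [← e2]; exact h
  have hxx : 0 < x ⬝ᵥ x := by
    have := dotProduct_self_eq_zero (v := x)
    have h0 : 0 ≤ x ⬝ᵥ x := Finset.sum_nonneg fun i _ => mul_self_nonneg (x i)
    exact lt_of_le_of_ne h0 (fun h => hx (this.1 h.symm))
  rw [← e, ← e]
  have hpos : 0 < ‖WithLp.toLp 2 (fun i => (x i : ℂ))‖ := by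
    rw [← e] at hxx
    refine lt_of_le_of_ne (norm_nonneg _) (fun h => ?_)
    rw [← h] at hxx
    simp at hxx
  have : ‖WithLp.toLp 2 (fun i => (((Sᵀ *ᵥ x) i : ℝ) : ℂ))‖ < ‖WithLp.toLp 2 (fun i => (x i : ℂ))‖ := by
    nlinarith
  gcongr

lemma lyap_of_stable {k : Type*} [Fintype k] [DecidableEq k] [Nonempty k] (M : Matrix k k ℝ)
    (hM : IsStableMatrix M) : ∃ P : Matrix k k ℝ, Pᵀ = P ∧ QP P ∧ QP (-(M * P)) := by
  set f : Matrix k k ℝ →+* Matrix k k ℂ := (algebraMap ℝ ℂ).mapMatrix with hf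
  have fdef : ∀ X, f X = X.map (algebraMap ℝ ℂ) := fun X => rfl
  have hun : ∀ μ : ℂ, 0 ≤ μ.re → IsUnit (algebraMap ℂ (Matrix k k ℂ) μ - f M) := by
    intro μ hμ
    by_contra h
    exact absurd (hM μ h) (not_lt.2 hμ)
  have h1 : IsUnit (1 - M).det := by
    have := hun 1 (by simp)
    rw [map_one, ← map_one f, ← map_sub, isUnit_iff_isUnit_det, hf, ← RingHom.map_det] at this
    rw [isUnit_iff_ne_zero] at this ⊢
    intro h0
    rw [h0] at this
    simp at this
  have h1' : (1 - M) * (1 - M)⁻¹ = 1 := mul_nonsing_inv _ h1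
  have h1'' : (1 - M)⁻¹ * (1 - M) = 1 := nonsing_inv_mul _ h1
  set S : Matrix k k ℝ := (1 - M)⁻¹ * (1 + M) with hS
  have hMS : (1 - M) * S = 1 + M := by rw [hS, ← mul_assoc, h1', one_mul]
  clear_value S
  have hspec : ∀ μ ∈ spectrum ℂ (f S), ‖μ‖ < 1 := by
    intro l hl
    by_contra! hc
    apply hl
    have hfac : (f (1 - M)) * (algebraMap ℂ (Matrix k k ℂ) l - f S) =
        (l - 1) • (1 : Matrix k k ℂ) - (l + 1) • f M := by
      rw [mul_sub, ← map_mul, hMS, Algebra.algebraMap_eq_smul_one]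
      simp only [map_sub, map_one, map_add, mul_smul_comm, mul_one]
      module
    have hu : IsUnit ((l - 1) • (1 : Matrix k k ℂ) - (l + 1) • f M) := by
      by_cases h : l + 1 = 0
      · have : l = -1 := by linear_combination h
        subst this
        norm_num
        have : (-2 : ℂ) • (1 : Matrix k k ℂ) = algebraMap ℂ _ (-2) := by
          rw [Algebra.algebraMap_eq_smul_one]
        exact ((by norm_num : (2:ℂ) ≠ 0).isUnit).map (algebraMap ℂ (Matrix k k ℂ)) |>.neg |> fun h => by
          simpa [Algebra.algebraMap_eq_smul_one] using h
      · have hre : 0 ≤ ((l - 1) / (l + 1)).re := by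
          rw [Complex.div_re, ← add_div]
          apply div_nonneg _ (Complex.normSq_nonneg _)
          have : 1 ≤ Complex.normSq l := by
            rw [Complex.normSq_eq_norm_sq]; nlinarith
          rw [Complex.normSq_apply] at this
          simp
          nlinarith
        have h2 := hun _ hre
        have h3 := ((Ne.isUnit h).map (algebraMap ℂ (Matrix k k ℂ))).mul h2
        convert h3 using 1
        simp only [Algebra.algebraMap_eq_smul_one, smul_mul_assoc, one_mul, smul_sub, smul_smul]
        congr 2
        field_simp
    rw [← hfac] at hu
    have hu1 : IsUnit (f (1 - M)) := ((isUnit_iff_isUnit_det _).2 h1).map f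
    obtain ⟨u, hu1⟩ := hu1
    rw [← hu1, Units.isUnit_units_mul] at hu
    exact hu
  obtain ⟨N, hN0, hN⟩ := exists_pow_norm_lt (f S) hspec
  rw [← map_pow] at hN
  have hN' := dot_lt_of_norm (S ^ N) hN
  set P : Matrix k k ℝ := ∑ i ∈ Finset.range N, S ^ i * (S ^ i)ᵀ with hP
  have hPs : Pᵀ = P := by
    rw [hP, transpose_sum]
    simp
  have quadS : ∀ (X : Matrix k k ℝ) (x : k → ℝ), x ⬝ᵥ ((X * Xᵀ) *ᵥ x) = (Xᵀ *ᵥ x) ⬝ᵥ (Xᵀ *ᵥ x) := by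
    intro X x
    have := quad_congr 1 Xᵀ x x
    simpa using this
  have nn : ∀ x : k → ℝ, 0 ≤ x ⬝ᵥ x := fun x => Finset.sum_nonneg fun i _ => mul_self_nonneg (x i)
  have pp : ∀ x : k → ℝ, x ≠ 0 → 0 < x ⬝ᵥ x := fun x hx =>
    lt_of_le_of_ne (nn x) (fun h => hx (dotProduct_self_eq_zero.1 h.symm))
  refine ⟨P, hPs, ?_, ?_⟩
  · intro x hx
    rw [hP, sum_mulVec, dotProduct_sum]
    refine Finset.sum_pos' (fun i _ => ?_) ⟨0, Finset.mem_range.2 hN0, ?_⟩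
    · rw [quadS]; exact nn _
    · rw [quadS]; simpa using pp x hx
  · have tel : P - S * P * Sᵀ = 1 - S ^ N * (S ^ N)ᵀ := by
      have h2 : S * P * Sᵀ = ∑ i ∈ Finset.range N, S ^ (i + 1) * (S ^ (i + 1))ᵀ := by
        rw [hP, Finset.mul_sum, Finset.sum_mul]
        refine Finset.sum_congr rfl fun i _ => ?_
        rw [pow_succ' S i, transpose_mul S (S ^ i)]
        simp only [mul_assoc]
      rw [h2, hP, ← Finset.sum_sub_distrib]
      have := Finset.sum_range_sub' (fun i => S ^ i * (S ^ i)ᵀ) N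
      rw [this]; simp
    have hQ : QP (P - S * P * Sᵀ) := by
      intro x hx
      rw [tel, sub_mulVec, dotProduct_sub, quadS, one_mulVec, sub_pos]
      exact hN' x hx
    have hQ2 := hQ.congr (1 - M)ᵀ (by rwa [det_transpose])
    have e : (1 - M)ᵀᵀ * (P - S * P * Sᵀ) * (1 - M)ᵀ = (2 : ℝ) • (-(M * P) - (M * P)ᵀ) := by
      have : (1 - M)ᵀᵀ * (P - S * P * Sᵀ) * (1 - M)ᵀ =
          (1 - M) * P * (1 - M)ᵀ - ((1 - M) * S) * P * ((1 - M) * S)ᵀ := by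
        rw [transpose_mul (1 - M) S, transpose_transpose, mul_sub, sub_mul]
        simp only [mul_assoc]
      rw [this, hMS, transpose_mul, hPs]
      simp only [transpose_sub, transpose_add, transpose_one, add_mul, sub_mul, mul_add, mul_sub,
        one_mul, mul_one]
      module
    rw [e] at hQ2
    intro x hx
    have := hQ2 x hx
    have e2 : x ⬝ᵥ ((M * P)ᵀ *ᵥ x) = x ⬝ᵥ ((M * P) *ᵥ x) := by
      rw [mulVec_transpose, dotProduct_comm, dotProduct_mulVec]
    rw [smul_mulVec, dotProduct_smul, sub_mulVec, dotProduct_sub, e2] at this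
    rw [neg_mulVec, dotProduct_neg] at this ⊢
    simp only [smul_eq_mul] at this
    linarith

lemma QP.isUnit_det {k : Type*} [Fintype k] [DecidableEq k] {P : Matrix k k ℝ} (h : QP P) :
    IsUnit P.det := by
  rw [isUnit_iff_ne_zero]
  intro h0
  obtain ⟨v, hv, hv0⟩ := exists_mulVec_eq_zero_iff.2 h0
  have := h v hv
  rw [hv0] at this
  simp at this

lemma QP.comb {k : Type*} [Fintype k] {M N : Matrix k k ℝ} (hM : QP M) (hN : QP N) {a b : ℝ}
    (ha : 0 ≤ a) (hb : 0 ≤ b) (hab : a + b = 1) : QP (a • M + b • N) := by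
  intro x hx
  rw [add_mulVec, smul_mulVec, smul_mulVec, dotProduct_add, dotProduct_smul, dotProduct_smul]
  simp only [smul_eq_mul]
  have h1 := hM x hx
  have h2 := hN x hx
  rcases ha.eq_or_lt with h | h
  · have : b = 1 := by linarith
    subst h; subst this; simpa using h2
  · have := mul_pos h h1
    have := mul_nonneg hb h2.le
    linarith

lemma QP.eventually {k : Type*} [Fintype k] {P : Matrix k k ℝ} (hP : QP P)
    (E : Matrix k k ℝ) : ∀ᶠ e : ℝ in nhds 0, QP (P + e • E) := by
  have hc : IsCompact (Metric.sphere (0 : k → ℝ) 1) := isCompact_sphere _ _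
  have hcont : Continuous (fun q : ℝ × (k → ℝ) => q.2 ⬝ᵥ ((P + q.1 • E) *ᵥ q.2)) := by
    fun_prop
  have := hc.eventually_forall_of_forall_eventually (x₀ := (0 : ℝ))
    (P := fun e x => 0 < x ⬝ᵥ ((P + e • E) *ᵥ x)) (by
      intro x hx
      have h0 : 0 < x ⬝ᵥ ((P + (0 : ℝ) • E) *ᵥ x) := by
        rw [zero_smul, add_zero]
        apply hP
        rintro rfl
        simp at hx
      exact hcont.continuousAt.eventually (lt_mem_nhds h0))
  filter_upwards [this] with e he x hx
  have hn : 0 < ‖x‖ := norm_pos_iff.2 hx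
  have h1 := he (‖x‖⁻¹ • x) (by simp [norm_smul, hn.ne'])
  rw [mulVec_smul, dotProduct_smul, smul_dotProduct] at h1
  simp only [smul_eq_mul] at h1
  have h2 : 0 < ‖x‖⁻¹ := inv_pos.2 hn
  exact pos_of_mul_pos_right (pos_of_mul_pos_right h1 h2.le) h2.le

lemma eventually_det_ne {n : ℕ} (V : Matrix (Fin n) (Fin n) ℝ) :
    ∀ᶠ e : ℝ in nhdsWithin 0 {0}ᶜ, (V + e • (1 : Matrix (Fin n) (Fin n) ℝ)).det ≠ 0 := by
  have hp : (-V).charpoly ≠ 0 := (charpoly_monic (-V)).ne_zero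
  have hfin : {e : ℝ | (-V).charpoly.IsRoot e}.Finite := Polynomial.finite_setOfPred_isRoot hp
  have h2 : ({e : ℝ | (-V).charpoly.IsRoot e} \ {0})ᶜ ∈ nhds (0 : ℝ) :=
    (hfin.subset Set.sdiff_subset).isClosed.isOpen_compl.mem_nhds (by simp)
  filter_upwards [nhdsWithin_le_nhds h2, self_mem_nhdsWithin] with e he he0 hd
  apply he
  refine ⟨?_, he0⟩
  change (-V).charpoly.eval e = 0
  rw [eval_charpoly, ← hd]
  congr 1
  rw [sub_neg_eq_add, add_comm, smul_one_eq_diagonal]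
  rfl

lemma exists_lyap_blocks {n : ℕ} (hn : 0 < n)
    (M : Matrix (Fin n ⊕ Fin n) (Fin n ⊕ Fin n) ℝ) (hM : IsStableMatrix M) :
    ∃ X V W : Matrix (Fin n) (Fin n) ℝ, Xᵀ = X ∧ Wᵀ = W ∧ IsUnit V.det ∧
      QP (fromBlocks X V Vᵀ W) ∧ QP (-(M * fromBlocks X V Vᵀ W)) := by
  have : Nonempty (Fin n ⊕ Fin n) := ⟨Sum.inl ⟨0, hn⟩⟩
  obtain ⟨P, hPs, hP, hMP⟩ := lyap_of_stable M hM
  obtain ⟨X, V, V', W, rfl⟩ : ∃ X V V' W, P = fromBlocks X V V' W :=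
    ⟨_, _, _, _, (fromBlocks_toBlocks P).symm⟩
  rw [fromBlocks_transpose, fromBlocks_inj] at hPs
  obtain ⟨hX, hV, hV', hW⟩ := hPs
  subst hV'
  set E : Matrix (Fin n ⊕ Fin n) (Fin n ⊕ Fin n) ℝ := fromBlocks 0 1 1 0 with hE
  have h1 := (hP.eventually E).filter_mono (nhdsWithin_le_nhds (s := {0}ᶜ))
  have h2 := (hMP.eventually (-(M * E))).filter_mono (nhdsWithin_le_nhds (s := {0}ᶜ))
  have h3 := eventually_det_ne V
  obtain ⟨e, he1, he2, he3⟩ := (h1.and (h2.and h3)).exists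
  have he : fromBlocks X V Vᵀ W + e • E =
      fromBlocks X (V + e • 1) (V + e • (1 : Matrix (Fin n) (Fin n) ℝ))ᵀ W := by
    rw [hE, fromBlocks_smul, fromBlocks_add]
    simp
  refine ⟨X, V + e • 1, W, hX, hW, isUnit_iff_ne_zero.2 he3, ?_, ?_⟩
  · rw [← he]; exact he1
  · rw [← he, Matrix.mul_add, neg_add, Matrix.mul_smul, ← smul_neg]
    exact he2

/-- The convex set of solutions of the linear matrix inequalities. -/
def FS {n m p : ℕ} (A : Matrix (Fin n) (Fin n) ℝ) (B : Matrix (Fin n) (Fin m) ℝ)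
    (C : Matrix (Fin p) (Fin n) ℝ) :
    Set (Matrix (Fin n) (Fin n) ℝ × Matrix (Fin n) (Fin n) ℝ × Matrix (Fin m) (Fin n) ℝ ×
      Matrix (Fin n) (Fin p) ℝ × Matrix (Fin n) (Fin n) ℝ) :=
  {z | z.1ᵀ = z.1 ∧ z.2.1ᵀ = z.2.1 ∧ QP (fromBlocks z.1 1 1 z.2.1) ∧
    QP (-(fromBlocks (A * z.1 + B * z.2.2.1) A z.2.2.2.2 (z.2.1 * A + z.2.2.2.1 * C)))}

lemma FS_convex {n m p : ℕ} (A : Matrix (Fin n) (Fin n) ℝ) (B : Matrix (Fin n) (Fin m) ℝ)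
    (C : Matrix (Fin p) (Fin n) ℝ) : Convex ℝ (FS A B C) := by
  rintro ⟨X, Y, F, H, M⟩ ⟨h1, h2, h3, h4⟩ ⟨X', Y', F', H', M'⟩ ⟨h1', h2', h3', h4'⟩ a b ha hb hab
  simp only at h1 h2 h3 h4 h1' h2' h3' h4'
  refine ⟨?_, ?_, ?_, ?_⟩
  · simp [h1, h1']
  · simp [h2, h2']
  · have := h3.comb h3' ha hb hab
    rw [fromBlocks_smul, fromBlocks_smul, fromBlocks_add, ← add_smul, hab, one_smul] at this
    exact this
  · have := h4.comb h4' ha hb hab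
    rw [smul_neg, smul_neg, ← neg_add, fromBlocks_smul, fromBlocks_smul, fromBlocks_add,
      ← add_smul, hab, one_smul] at this
    have e1 : a • (A * X + B * F) + b • (A * X' + B * F') =
        A * (a • X + b • X') + B * (a • F + b • F') := by
      simp only [Matrix.mul_add, Matrix.mul_smul, smul_add]
      abel
    have e2 : a • (Y * A + H * C) + b • (Y' * A + H' * C) =
        (a • Y + b • Y') * A + (a • H + b • H') * C := by
      simp only [Matrix.add_mul, Matrix.smul_mul, smul_add]
      abel
    rw [e1, e2] at this
    exact this

/-- The controller reconstructed from a solution of the linear matrix inequalities. -/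
def Psi {n m p : ℕ} (A : Matrix (Fin n) (Fin n) ℝ) (B : Matrix (Fin n) (Fin m) ℝ)
    (C : Matrix (Fin p) (Fin n) ℝ)
    (z : Matrix (Fin n) (Fin n) ℝ × Matrix (Fin n) (Fin n) ℝ × Matrix (Fin m) (Fin n) ℝ ×
      Matrix (Fin n) (Fin p) ℝ × Matrix (Fin n) (Fin n) ℝ) :
    Matrix (Fin n) (Fin n) ℝ × Matrix (Fin n) (Fin p) ℝ × Matrix (Fin m) (Fin n) ℝ :=
  ((1 - z.2.1 * z.1)⁻¹ *
      (z.2.2.2.2 - z.2.1 * (A * z.1 + B * z.2.2.1) - z.2.2.2.1 * C * z.1),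
    (1 - z.2.1 * z.1)⁻¹ * z.2.2.2.1, z.2.2.1)

lemma continuousOn_matrix_inv {n : ℕ} :
    ContinuousOn (fun M : Matrix (Fin n) (Fin n) ℝ => M⁻¹) {M | M.det ≠ 0} := by
  have : (fun M : Matrix (Fin n) (Fin n) ℝ => M⁻¹) = fun M => (M.det)⁻¹ • M.adjugate := by
    ext1 M
    rw [inv_def, Ring.inverse_eq_inv']
  rw [this]
  refine ContinuousOn.smul (ContinuousOn.inv₀ ?_ (fun M hM => hM)) ?_
  · exact (continuous_id.matrix_det).continuousOn
  · exact (continuous_id.matrix_adjugate).continuousOn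

lemma det_ne_of_QP {n : ℕ} {X Y : Matrix (Fin n) (Fin n) ℝ} (hX : Xᵀ = X)
    (h : QP (fromBlocks X 1 1 Y)) : (1 - Y * X).det ≠ 0 := by
  intro h0
  obtain ⟨v, hv, hv0⟩ := exists_mulVec_eq_zero_iff.2 h0
  have hv1 : Y *ᵥ (X *ᵥ v) = v := by
    rw [sub_mulVec, one_mulVec, sub_eq_zero, ← mulVec_mulVec] at hv0
    exact hv0.symm
  have := h (Sum.elim v (-(X *ᵥ v))) (by
    intro h1
    apply hv
    ext i
    exact congrFun h1 (Sum.inl i))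
  rw [fromBlocks_mulVec, sumElim_dotProduct_sumElim] at this
  simp [mulVec_neg, hv1] at this

lemma Psi_continuousOn {n m p : ℕ} (A : Matrix (Fin n) (Fin n) ℝ) (B : Matrix (Fin n) (Fin m) ℝ)
    (C : Matrix (Fin p) (Fin n) ℝ) : ContinuousOn (Psi A B C) (FS A B C) := by
  have h1 : ContinuousOn (fun z : Matrix (Fin n) (Fin n) ℝ × Matrix (Fin n) (Fin n) ℝ ×
      Matrix (Fin m) (Fin n) ℝ × Matrix (Fin n) (Fin p) ℝ × Matrix (Fin n) (Fin n) ℝ =>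
      (1 - z.2.1 * z.1)⁻¹) (FS A B C) := by
    refine ContinuousOn.comp continuousOn_matrix_inv (f := fun z : Matrix (Fin n) (Fin n) ℝ ×
      Matrix (Fin n) (Fin n) ℝ ×
      Matrix (Fin m) (Fin n) ℝ × Matrix (Fin n) (Fin p) ℝ × Matrix (Fin n) (Fin n) ℝ =>
      (1 - z.2.1 * z.1)) ?_ ?_
    · apply Continuous.continuousOn
      fun_prop
    · intro z hz
      exact det_ne_of_QP hz.1 hz.2.2.1
  unfold Psi
  have hmul : ∀ {a b c : ℕ} {Z : Type} [TopologicalSpace Z] {s : Set Z}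
      {f : Z → Matrix (Fin a) (Fin b) ℝ}
      {g : Z → Matrix (Fin b) (Fin c) ℝ}, ContinuousOn f s → ContinuousOn g s →
      ContinuousOn (fun z => f z * g z) s := by
    intro a b c Z _ s f g hf hg
    rw [continuousOn_iff_continuous_domRestrict] at *
    exact hf.matrix_mul hg
  refine ContinuousOn.prodMk (hmul h1 ?_) (ContinuousOn.prodMk (hmul h1 ?_) ?_)
  all_goals
    apply Continuous.continuousOn
    fun_prop

lemma Psi_mem {n m p : ℕ} (A : Matrix (Fin n) (Fin n) ℝ) (B : Matrix (Fin n) (Fin m) ℝ)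
    (C : Matrix (Fin p) (Fin n) ℝ) : ∀ z ∈ FS A B C, Psi A B C z ∈ Cn A B C := by
  rintro ⟨X, Y, F, H, M⟩ ⟨h1, h2, h3, h4⟩
  simp only at h1 h2 h3 h4
  have hU := det_ne_of_QP h1 h3
  set U := 1 - Y * X with hUdef
  have hUU : U * U⁻¹ = 1 := mul_nonsing_inv _ (isUnit_iff_ne_zero.2 hU)
  set P1 : Matrix (Fin n ⊕ Fin n) (Fin n ⊕ Fin n) ℝ := fromBlocks X 1 1 0 with hP1
  set P2 : Matrix (Fin n ⊕ Fin n) (Fin n ⊕ Fin n) ℝ := fromBlocks 1 Y 0 Uᵀ with hP2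
  have hP2u : IsUnit P2.det := by
    rw [hP2, det_fromBlocks_zero₂₁, det_transpose, det_one, one_mul]
    exact isUnit_iff_ne_zero.2 hU
  have hP2t : P2ᵀ = fromBlocks 1 0 Y U := by
    rw [hP2, fromBlocks_transpose]; simp [h2]
  have e1 : P2ᵀ * P1 = fromBlocks X 1 1 Y := by
    rw [hP2t, hP1, fromBlocks_multiply]
    simp [hUdef]
  have e2 : P2ᵀ * Acl A B C (Psi A B C (X, Y, F, H, M)) * P1 =
      fromBlocks (A * X + B * F) A M (Y * A + H * C) := by
    rw [hP2t, hP1, Acl, Psi, fromBlocks_multiply, fromBlocks_multiply]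
    simp only [← hUdef]
    have c1 : U * (U⁻¹ * H * C) = H * C := by
      rw [Matrix.mul_assoc, ← Matrix.mul_assoc U U⁻¹, hUU, Matrix.one_mul]
    have c2 : U * (U⁻¹ * (M - Y * (A * X + B * F) - H * C * X)) =
        M - Y * (A * X + B * F) - H * C * X := by
      rw [← Matrix.mul_assoc U U⁻¹, hUU, one_mul]
    rw [fromBlocks_inj]
    refine ⟨by simp, by simp, ?_, by simp [c1]⟩
    rw [c1, c2]
    simp only [Matrix.mul_add, Matrix.add_mul, mul_one, Matrix.mul_assoc]
    abel
  have hcan : P1 * P2⁻¹ * P2 = P1 := by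
    rw [Matrix.mul_assoc, nonsing_inv_mul _ hP2u, mul_one]
  have hPs : (P1 * P2⁻¹)ᵀ = P1 * P2⁻¹ := by
    have hs : (P2ᵀ * P1)ᵀ = P2ᵀ * P1 := by
      rw [e1, fromBlocks_transpose]; simp [h1, h2]
    rw [transpose_mul, transpose_transpose] at hs
    have hu' : IsUnit P2ᵀ.det := by rwa [det_transpose]
    rw [transpose_mul, transpose_nonsing_inv]
    calc P2ᵀ⁻¹ * P1ᵀ = P2ᵀ⁻¹ * (P1ᵀ * P2) * P2⁻¹ := by
          rw [Matrix.mul_assoc, Matrix.mul_assoc, mul_nonsing_inv _ hP2u, mul_one]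
      _ = P1 * P2⁻¹ := by
          rw [hs, ← Matrix.mul_assoc, nonsing_inv_mul _ hu', one_mul]
  refine stable_of_lyap _ (P1 * P2⁻¹) hPs ?_ ?_
  · apply QP.of_congr P2 hP2u
    rw [Matrix.mul_assoc, hcan, e1]
    exact h3
  · apply QP.of_congr P2 hP2u
    rw [mul_neg, neg_mul]
    have : P2ᵀ * (Acl A B C (Psi A B C (X, Y, F, H, M)) * (P1 * P2⁻¹)) * P2 =
        P2ᵀ * Acl A B C (Psi A B C (X, Y, F, H, M)) * (P1 * P2⁻¹ * P2) := by
      simp only [Matrix.mul_assoc]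
    rw [this, hcan, e2]
    exact h4

lemma exists_Psi {n m p : ℕ} (hn : 0 < n) (A : Matrix (Fin n) (Fin n) ℝ)
    (B : Matrix (Fin n) (Fin m) ℝ) (C : Matrix (Fin p) (Fin n) ℝ)
    (K : Matrix (Fin n) (Fin n) ℝ × Matrix (Fin n) (Fin p) ℝ × Matrix (Fin m) (Fin n) ℝ)
    (hK : K ∈ Cn A B C) :
    ∃ z ∈ FS A B C, ∃ S : Matrix (Fin n) (Fin n) ℝ, S.det ≠ 0 ∧ Psi A B C z = simT S K := by
  obtain ⟨AK, BK, CK⟩ := K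
  obtain ⟨X, V, W, hX, hW, hV, hP, hMP⟩ := exists_lyap_blocks hn _ hK
  set P := fromBlocks X V Vᵀ W with hPdef
  have hPu := hP.isUnit_det
  have hPs : Pᵀ = P := by rw [hPdef, fromBlocks_transpose, hX, hW, transpose_transpose]
  have hPis : (P⁻¹)ᵀ = P⁻¹ := by rw [transpose_nonsing_inv, hPs]
  obtain ⟨Y, U, U', Z, hPi⟩ : ∃ Y U U' Z, P⁻¹ = fromBlocks Y U U' Z :=
    ⟨_, _, _, _, (fromBlocks_toBlocks P⁻¹).symm⟩
  rw [hPi, fromBlocks_transpose, fromBlocks_inj] at hPis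
  obtain ⟨hY, -, hU', -⟩ := hPis
  subst hU'
  have hPP : P * P⁻¹ = 1 := mul_nonsing_inv _ hPu
  rw [hPi, hPdef, fromBlocks_multiply, ← fromBlocks_one, fromBlocks_inj] at hPP
  obtain ⟨q1, -, q3, -⟩ := hPP
  have hVt : IsUnit Vᵀ.det := by rwa [det_transpose]
  set P1 : Matrix (Fin n ⊕ Fin n) (Fin n ⊕ Fin n) ℝ := fromBlocks X 1 Vᵀ 0 with hP1
  set P2 : Matrix (Fin n ⊕ Fin n) (Fin n ⊕ Fin n) ℝ := fromBlocks 1 Y 0 Uᵀ with hP2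
  have hPP2 : P * P2 = P1 := by
    rw [hPdef, hP2, hP1, fromBlocks_multiply]
    simp [q1, q3]
  have hP1u : IsUnit P1.det := by
    apply isUnit_det_of_right_inverse (B := fromBlocks 0 Vᵀ⁻¹ 1 (-(X * Vᵀ⁻¹)))
    rw [hP1, fromBlocks_multiply, ← fromBlocks_one]
    simp [mul_nonsing_inv _ hVt]
  have hP2u : IsUnit P2.det := by
    rw [← hPP2, det_mul] at hP1u
    exact isUnit_of_mul_isUnit_right hP1u
  have hUu : IsUnit U.det := by
    rw [hP2, det_fromBlocks_zero₂₁, det_transpose, det_one, one_mul] at hP2u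
    exact hP2u
  have hP2t : P2ᵀ = fromBlocks 1 0 Y U := by
    rw [hP2, fromBlocks_transpose]; simp [hY]
  have q1' : Y * X + U * Vᵀ = 1 := by
    have := congrArg transpose q1
    simpa [hX, hY] using this
  have q1'' : 1 - Y * X = U * Vᵀ := by rw [← q1']; abel
  have r1 := hP.congr P2 hP2u
  have r2 := hMP.congr P2 hP2u
  rw [Matrix.mul_assoc, hPP2, hP2t, hP1, fromBlocks_multiply] at r1
  rw [mul_neg, neg_mul, Matrix.mul_assoc, Matrix.mul_assoc, hPP2, hP2t, hP1, Acl, fromBlocks_multiply,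
    fromBlocks_multiply] at r2
  simp only [one_mul, zero_mul, mul_one, mul_zero, add_zero, zero_add, q1'] at r1 r2
  refine ⟨(X, Y, CK * Vᵀ, U * BK, Y * (A * X + B * CK * Vᵀ) + U * (BK * C * X + AK * Vᵀ)),
    ⟨hX, hY, r1, ?_⟩, Vᵀ⁻¹, ?_, ?_⟩
  · have g1 : B * CK * Vᵀ = B * (CK * Vᵀ) := Matrix.mul_assoc _ _ _
    have g2 : U * (BK * C) = U * BK * C := (Matrix.mul_assoc _ _ _).symm
    rw [g2] at r2
    simp only [← g1]
    exact r2
  · exact (isUnit_nonsing_inv_det _ hVt).ne_zero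
  · have hUi : U⁻¹ * U = 1 := nonsing_inv_mul _ hUu
    have hUi' : ∀ {a : ℕ} (N : Matrix (Fin n) (Fin a) ℝ), U⁻¹ * (U * N) = N := by
      intro a N; rw [← Matrix.mul_assoc, hUi, Matrix.one_mul]
    unfold Psi simT
    simp only [q1'', Matrix.mul_inv_rev, nonsing_inv_nonsing_inv _ hVt]
    refine Prod.ext ?_ (Prod.ext ?_ rfl)
    · have : Y * (A * X + B * CK * Vᵀ) + U * (BK * C * X + AK * Vᵀ) -
          Y * (A * X + B * (CK * Vᵀ)) - U * BK * C * X = U * (AK * Vᵀ) := by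
        simp only [Matrix.mul_add, Matrix.mul_assoc]
        abel
      simp only [this]
      rw [Matrix.mul_assoc, hUi', Matrix.mul_assoc]
    · simp only [Matrix.mul_assoc, hUi']

lemma simT_mem {n m p : ℕ} (hn : 0 < n) (A : Matrix (Fin n) (Fin n) ℝ)
    (B : Matrix (Fin n) (Fin m) ℝ) (C : Matrix (Fin p) (Fin n) ℝ)
    (K : Matrix (Fin n) (Fin n) ℝ × Matrix (Fin n) (Fin p) ℝ × Matrix (Fin m) (Fin n) ℝ)
    (hK : K ∈ Cn A B C) (S : Matrix (Fin n) (Fin n) ℝ) (hS : S.det ≠ 0) :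
    simT S K ∈ Cn A B C := by
  have : Nonempty (Fin n ⊕ Fin n) := ⟨Sum.inl ⟨0, hn⟩⟩
  obtain ⟨P, hPs, hP, hMP⟩ := lyap_of_stable _ hK
  have hSu := isUnit_iff_ne_zero.2 hS
  set J : Matrix (Fin n ⊕ Fin n) (Fin n ⊕ Fin n) ℝ := fromBlocks 1 0 0 Sᵀ with hJ
  have hJu : IsUnit J.det := by
    rw [hJ, det_fromBlocks_zero₂₁, det_transpose, det_one, one_mul]
    exact hSu
  have hJt : Jᵀ = fromBlocks 1 0 0 S := by rw [hJ, fromBlocks_transpose]; simp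
  have hA : Acl A B C (simT S K) * Jᵀ = Jᵀ * Acl A B C K := by
    rw [hJt, Acl, Acl, simT, fromBlocks_multiply, fromBlocks_multiply]
    simp only [Matrix.mul_assoc, nonsing_inv_mul _ hSu]
    simp
  refine stable_of_lyap _ (Jᵀ * P * J) ?_ (hP.congr J hJu) ?_
  · simp [transpose_mul, hPs, Matrix.mul_assoc]
  · have := hMP.congr J hJu
    convert this using 1
    rw [← Matrix.mul_assoc, ← Matrix.mul_assoc, hA]
    simp [Matrix.mul_assoc]

lemma simT_simT {n m p : ℕ} (S R : Matrix (Fin n) (Fin n) ℝ)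
    (K : Matrix (Fin n) (Fin n) ℝ × Matrix (Fin n) (Fin p) ℝ × Matrix (Fin m) (Fin n) ℝ) :
    simT S (simT R K) = simT (S * R) K := by
  simp [simT, Matrix.mul_assoc, Matrix.mul_inv_rev]

lemma simT_one {n m p : ℕ}
    (K : Matrix (Fin n) (Fin n) ℝ × Matrix (Fin n) (Fin p) ℝ × Matrix (Fin m) (Fin n) ℝ) :
    simT 1 K = K := by
  simp [simT]

lemma simT_continuous {n m p : ℕ} (S : Matrix (Fin n) (Fin n) ℝ) :
    Continuous (simT S : Matrix (Fin n) (Fin n) ℝ × Matrix (Fin n) (Fin p) ℝ ×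
      Matrix (Fin m) (Fin n) ℝ → _) := by
  unfold simT
  fun_prop

lemma simT_joined {n m p : ℕ} (hn : 0 < n) {A : Matrix (Fin n) (Fin n) ℝ}
    {B : Matrix (Fin n) (Fin m) ℝ} {C : Matrix (Fin p) (Fin n) ℝ}
    {K K' : Matrix (Fin n) (Fin n) ℝ × Matrix (Fin n) (Fin p) ℝ × Matrix (Fin m) (Fin n) ℝ}
    (h : JoinedIn (Cn A B C) K K') (S : Matrix (Fin n) (Fin n) ℝ) (hS : S.det ≠ 0) :
    JoinedIn (Cn A B C) (simT S K) (simT S K') := by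
  refine (h.map (simT_continuous S)).mono ?_
  rintro _ ⟨L, hL, rfl⟩
  exact simT_mem hn A B C L hL S hS

lemma simT_pos_joined {n m p : ℕ} (hn : 0 < n) {A : Matrix (Fin n) (Fin n) ℝ}
    {B : Matrix (Fin n) (Fin m) ℝ} {C : Matrix (Fin p) (Fin n) ℝ}
    {K : Matrix (Fin n) (Fin n) ℝ × Matrix (Fin n) (Fin p) ℝ × Matrix (Fin m) (Fin n) ℝ}
    (hK : K ∈ Cn A B C) (S : Matrix (Fin n) (Fin n) ℝ) (hS : 0 < S.det) :
    JoinedIn (Cn A B C) K (simT S K) := by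
  have h : JoinedIn _ 1 S := GLJ_of_det_pos hn S hS
  have hinv : ContinuousOn (fun M : Matrix (Fin n) (Fin n) ℝ => M⁻¹) {M | 0 < M.det} :=
    continuousOn_matrix_inv.mono (fun M hM => ne_of_gt hM)
  have hc : ContinuousOn (fun M => simT M K) {M : Matrix (Fin n) (Fin n) ℝ | 0 < M.det} := by
    unfold simT
    rw [continuousOn_iff_continuous_domRestrict] at *
    have hid : Continuous (fun M : {M : Matrix (Fin n) (Fin n) ℝ | 0 < M.det} =>
      (M : Matrix (Fin n) (Fin n) ℝ)) := continuous_subtype_val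
    exact ((hid.matrix_mul continuous_const).matrix_mul hinv).prodMk
      ((hid.matrix_mul continuous_const).prodMk (continuous_const.matrix_mul hinv))
  have h2 := h.map_continuousOn hc
  simp only [simT_one] at h2
  refine h2.mono ?_
  rintro _ ⟨M, hM, rfl⟩
  exact simT_mem hn A B C K hK M (ne_of_gt hM)

lemma exists_simT_joined {n m p : ℕ} (hn : 0 < n) {A : Matrix (Fin n) (Fin n) ℝ}
    {B : Matrix (Fin n) (Fin m) ℝ} {C : Matrix (Fin p) (Fin n) ℝ}
    {K K' : Matrix (Fin n) (Fin n) ℝ × Matrix (Fin n) (Fin p) ℝ × Matrix (Fin m) (Fin n) ℝ}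
    (hK : K ∈ Cn A B C) (hK' : K' ∈ Cn A B C) :
    ∃ S : Matrix (Fin n) (Fin n) ℝ, S.det ≠ 0 ∧ JoinedIn (Cn A B C) (simT S K) K' := by
  obtain ⟨z, hz, S, hS, hzS⟩ := exists_Psi hn A B C K hK
  obtain ⟨z', hz', S', hS', hzS'⟩ := exists_Psi hn A B C K' hK'
  have h := ((FS_convex A B C).isPathConnected ⟨z, hz⟩).joinedIn z hz z' hz'
  have h2 : JoinedIn (Cn A B C) (Psi A B C z) (Psi A B C z') := by
    refine (h.map_continuousOn (Psi_continuousOn A B C)).mono ?_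
    rintro _ ⟨w, hw, rfl⟩
    exact Psi_mem A B C w hw
  rw [hzS, hzS'] at h2
  have hu := isUnit_iff_ne_zero.2 hS'
  have hi : S'⁻¹.det ≠ 0 := (isUnit_nonsing_inv_det _ hu).ne_zero
  have h3 := simT_joined hn h2 S'⁻¹ hi
  rw [simT_simT, simT_simT, nonsing_inv_mul _ hu, simT_one] at h3
  exact ⟨S'⁻¹ * S, by rw [det_mul]; exact mul_ne_zero hi hS, h3⟩

/-- Assume `(A, B)` controllable, `(C, A)` observable, and `𝒞_n` not
path-connected. Then for every `T` with `det T < 0` and every `K ∈ 𝒞_n`: (i) `𝒯(T, K)` is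
not in the path component of `K` within `𝒞_n`; (ii) `𝒯(T, ·)` is a homeomorphism from the
path component of `K` onto the path component of `𝒯(T, K)` (a continuous bijection with
continuous inverse `𝒯(T⁻¹, ·)`); (iii) every element of `𝒞_n` lies in the path component
of `K` or in that of `𝒯(T, K)`. -/
theorem Cn_two_components_diffeomorphic (n m p : ℕ) (hn : 0 < n) (hm : 0 < m) (hp : 0 < p)
    (A : Matrix (Fin n) (Fin n) ℝ) (B : Matrix (Fin n) (Fin m) ℝ)
    (C : Matrix (Fin p) (Fin n) ℝ)
    (hctrb : Controllable A B) (hobs : Controllable Aᵀ Cᵀ)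
    (hnc : ¬ IsPathConnected (Cn A B C))
    (T : Matrix (Fin n) (Fin n) ℝ) (hT : T.det < 0)
    (K : Matrix (Fin n) (Fin n) ℝ × Matrix (Fin n) (Fin p) ℝ × Matrix (Fin m) (Fin n) ℝ)
    (hK : K ∈ Cn A B C) :
    ¬ JoinedIn (Cn A B C) K (simT T K) ∧
    Set.BijOn (simT T) {K' | JoinedIn (Cn A B C) K K'}
      {K' | JoinedIn (Cn A B C) (simT T K) K'} ∧
    ContinuousOn (simT T) {K' | JoinedIn (Cn A B C) K K'} ∧
    ContinuousOn (simT T⁻¹) {K' | JoinedIn (Cn A B C) (simT T K) K'} ∧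
    (∀ K' ∈ {K' | JoinedIn (Cn A B C) K K'}, simT T⁻¹ (simT T K') = K') ∧
    (∀ K' ∈ {K' | JoinedIn (Cn A B C) (simT T K) K'}, simT T (simT T⁻¹ K') = K') ∧
    (∀ K' ∈ Cn A B C, JoinedIn (Cn A B C) K K' ∨ JoinedIn (Cn A B C) (simT T K) K') := by
  have hT0 : T.det ≠ 0 := hT.ne
  have hTu : IsUnit T.det := isUnit_iff_ne_zero.2 hT0
  have hTi : T⁻¹.det ≠ 0 := (isUnit_nonsing_inv_det _ hTu).ne_zero
  have hTi' : T⁻¹.det < 0 := by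
    have h1 : T.det * T⁻¹.det = 1 := by rw [← det_mul, mul_nonsing_inv _ hTu, det_one]
    by_contra! hc
    nlinarith
  have c1 : ∀ L : Matrix (Fin n) (Fin n) ℝ × Matrix (Fin n) (Fin p) ℝ × Matrix (Fin m) (Fin n) ℝ,
      simT T⁻¹ (simT T L) = L := by
    intro L
    rw [simT_simT, nonsing_inv_mul _ hTu, simT_one]
  have c2 : ∀ L : Matrix (Fin n) (Fin n) ℝ × Matrix (Fin n) (Fin p) ℝ × Matrix (Fin m) (Fin n) ℝ,
      simT T (simT T⁻¹ L) = L := by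
    intro L
    rw [simT_simT, mul_nonsing_inv _ hTu, simT_one]
  have h3 : ∀ K' ∈ Cn A B C,
      JoinedIn (Cn A B C) K K' ∨ JoinedIn (Cn A B C) (simT T K) K' := by
    intro K' hK'
    obtain ⟨S, hS, hj⟩ := exists_simT_joined hn hK hK'
    rcases lt_or_gt_of_ne hS with h | h
    · right
      have hd : 0 < (T⁻¹ * S).det := by
        rw [det_mul]; exact mul_pos_of_neg_of_neg hTi' h
      have h4 := simT_joined hn (simT_pos_joined hn hK _ hd) T hT0
      rw [simT_simT, ← mul_assoc, mul_nonsing_inv _ hTu, one_mul] at h4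
      exact h4.trans hj
    · exact Or.inl ((simT_pos_joined hn hK S h).trans hj)
  refine ⟨?_, ⟨?_, ?_, ?_⟩, (simT_continuous T).continuousOn, (simT_continuous T⁻¹).continuousOn,
    fun L _ => c1 L, fun L _ => c2 L, h3⟩
  · intro hj
    apply hnc
    refine ⟨K, hK, ?_⟩
    intro L hL
    rcases h3 L hL with h | h
    · exact h
    · exact hj.trans h
  · intro L hL
    exact simT_joined hn hL T hT0
  · intro L _ L' _ he
    rw [← c1 L, ← c1 L', he]
  · intro L hL
    refine ⟨simT T⁻¹ L, ?_, c2 L⟩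
    have := simT_joined hn hL T⁻¹ hTi
    rw [c1] at this
    exact this
end
end
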